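/- arXiv:1804.00990 — 2 statements merged into one kernel-verified Lean document; each statement's English description precedes it below -/
import Mathlib

section
/- Let ω = (4,1,1) (so ω_1 = 4, ω_2 = ω_3 = 1, ω_i = 0 for i > 3; deg ω = 10), and set p_6 = x_1x_2x_3x_4x_5^6 + x_1x_2x_3x_4^6x_5 + x_1x_2x_3^6x_4x_5 + x_1x_2^6x_3x_4x_5 + x_1^3x_2x_3x_4x_5^4 + x_1^3x_2x_3x_4^4x_5 + x_1^3x_2x_3^4x_4x_5 + x_1^3x_2^4x_3x_4x_5. Then: (i) p_6 ∉ A^+P_5 + P_5^−(ω) and ρ_i(p_6) + p_6 ∈ A^+P_5 + P_5^−(ω) for all 1 ≤ i ≤ 5; (ii) every f ∈ P_5(ω) with ρ_i(f) + f ∈ A^+P_5 + P_5^−(ω) for all 1 ≤ i ≤ 5 satisfies f ∈ A^+P_5 + P_5^−(ω) or f + p_6 ∈ A^+P_5 + P_5^−(ω). (Equivalently, the GL_5-invariant subspace of QP_5(4,1,1) is one-dimensional, spanned by the class of p_6.) -/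
open MvPolynomial

noncomputable section

/-- `P n` is the polynomial algebra `F_2[x_1, …, x_n]`, with `x_{k+1}` corresponding to
the variable indexed by `k : Fin n`. -/
abbrev P (n : ℕ) : Type := MvPolynomial (Fin n) (ZMod 2)

/-- The total Steenrod square, the ring homomorphism determined by `x_i ↦ x_i + x_i^2`. -/
def sqTot (n : ℕ) : P n →ₐ[ZMod 2] P n := bind₁ fun i => X i + X i ^ 2

/-- The Steenrod square `Sq^k`: on a homogeneous polynomial of degree `d` it is the
homogeneous component of degree `d + k` of the total square, extended additively. -/
def SqK (n k : ℕ) (f : P n) : P n :=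
  ∑ d ∈ Finset.range (f.totalDegree + 1),
    homogeneousComponent (d + k) (sqTot n (homogeneousComponent d f))

/-- `A^+ P_n = Σ_{j ≥ 1} Sq^j(P_n)`, the submodule of hit polynomials. -/
def hitS (n : ℕ) : Submodule (ZMod 2) (P n) :=
  Submodule.span (ZMod 2) {g | ∃ j, 1 ≤ j ∧ ∃ h, g = SqK n j h}

/-- `A_s^+ P_n = Σ_{1 ≤ j < 2^s} Sq^j(P_n)`. -/
def AplusS (n s : ℕ) : Submodule (ZMod 2) (P n) :=
  Submodule.span (ZMod 2) {g | ∃ j, 1 ≤ j ∧ j < 2 ^ s ∧ ∃ h, g = SqK n j h}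

/-- Degree of a monomial given by its exponent vector. -/
def mdeg {n : ℕ} (a : Fin n →₀ ℕ) : ℕ := ∑ j, a j

/-- The weight vector of a monomial, zero-based: `wt a i = ω_{i+1}(x) = Σ_j α_i(a_j)`. -/
def wt {n : ℕ} (a : Fin n →₀ ℕ) (i : ℕ) : ℕ := ∑ j, a j / 2 ^ i % 2

/-- Left-lexicographic strict order on weight vectors. -/
def lexLt (w w' : ℕ → ℕ) : Prop := ∃ i, (∀ j, j < i → w j = w' j) ∧ w i < w' i

def lexLe (w w' : ℕ → ℕ) : Prop := w = w' ∨ lexLt w w'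

/-- `P_n^-(ω)`: span of monomials of degree `D = deg ω` with weight vector `< ω`. -/
def PnLt (n D : ℕ) (w : ℕ → ℕ) : Submodule (ZMod 2) (P n) :=
  Submodule.span (ZMod 2)
    {p | ∃ a : Fin n →₀ ℕ, mdeg a = D ∧ lexLt (wt a) w ∧ p = monomial a 1}

/-- `P_n(ω)`: span of monomials of degree `D = deg ω` with weight vector `≤ ω`. -/
def PnLe (n D : ℕ) (w : ℕ → ℕ) : Submodule (ZMod 2) (P n) :=
  Submodule.span (ZMod 2)
    {p | ∃ a : Fin n →₀ ℕ, mdeg a = D ∧ lexLe (wt a) w ∧ p = monomial a 1}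

/-- The order on monomials (of a common degree): first by weight vector, then by
exponent vector, both left-lexicographically. -/
def monLt {n : ℕ} (a b : Fin n →₀ ℕ) : Prop :=
  lexLt (wt a) (wt b) ∨
    (wt a = wt b ∧ ∃ j : Fin n, (∀ k, k < j → a k = b k) ∧ a j < b j)

/-- A monomial is inadmissible if it is congruent, modulo hit elements, to a sum of
strictly smaller monomials of the same degree. -/
def Inadmissible {n : ℕ} (a : Fin n →₀ ℕ) : Prop :=
  ∃ S : Finset (Fin n →₀ ℕ), (∀ b ∈ S, mdeg b = mdeg a ∧ monLt b a) ∧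
    ((monomial a 1 : P n) + ∑ b ∈ S, monomial b 1) ∈ hitS n

def Admissible {n : ℕ} (a : Fin n →₀ ℕ) : Prop := ¬ Inadmissible a

/-- Strict inadmissibility: with `s` the top of the weight vector, the monomial is
congruent to a sum of smaller monomials modulo `A_s^+ P_n`. -/
def StrictlyInadmissible {n : ℕ} (a : Fin n →₀ ℕ) : Prop :=
  ∃ s : ℕ, 1 ≤ s ∧ wt a (s - 1) ≠ 0 ∧ (∀ i, s ≤ i → wt a i = 0) ∧
    ∃ S : Finset (Fin n →₀ ℕ), (∀ b ∈ S, mdeg b = mdeg a ∧ monLt b a) ∧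
      ((monomial a 1 : P n) + ∑ b ∈ S, monomial b 1) ∈ AplusS n s

/-- Exponent vector from a tuple of exponents. -/
def ev {n : ℕ} (v : Fin n → ℕ) : Fin n →₀ ℕ := Finsupp.equivFunOnFinite.symm v

/-- `ν_k(x)`, the exponent of the (1-based) variable `x_k` in a monomial. -/
def nuE {m : ℕ} (b : Fin m →₀ ℕ) (k : ℕ) : ℕ := if h : k - 1 < m then b ⟨k - 1, h⟩ else 0

/-- `u`-compatibility of a monomial of `P_{n-1}` with a pair `(i; I)` (only `I` matters);
by convention every monomial is `1`-compatible with `(i; ∅)`. -/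
def uCompat {m : ℕ} (I : List ℕ) (u : ℕ) (b : Fin m →₀ ℕ) : Prop :=
  if I = [] then u = 1 else
    1 ≤ u ∧ u ≤ I.length ∧
    (∀ t, 1 ≤ t → t < u → nuE b (I.getD (t - 1) 0 - 1) = 2 ^ I.length - 1) ∧
    2 ^ I.length - 1 < nuE b (I.getD (u - 1) 0 - 1) ∧
    (∀ t, 1 ≤ t → t ≤ u → Nat.testBit (nuE b (I.getD (u - 1) 0 - 1)) (I.length - t) = true) ∧
    (∀ t, u < t → t ≤ I.length → Nat.testBit (nuE b (I.getD (t - 1) 0 - 1)) (I.length - t) = true)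

/-- The exponent vector of `x_{(I,u)} = x_{i_u}^{2^{r-1}+⋯+2^{r-u}} Π_{u<t≤r} x_{i_t}^{2^{r-t}}`. -/
def xIuExp (n : ℕ) (I : List ℕ) (u : ℕ) : Fin n → ℕ := fun k =>
  (if I.getD (u - 1) 0 = (k : ℕ) + 1 then 2 ^ I.length - 2 ^ (I.length - u) else 0) +
  ∑ t ∈ Finset.Icc (u + 1) I.length,
    if I.getD (t - 1) 0 = (k : ℕ) + 1 then 2 ^ (I.length - t) else 0

/-- The variable substitution underlying `f_i : P_{n-1} → P_n` (`x_j ↦ x_j` for `j < i`,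
`x_j ↦ x_{j+1}` for `j ≥ i`, in 1-based labels). -/
def fIdx (n i : ℕ) (j : Fin (n - 1)) : Fin n :=
  if (j : ℕ) + 1 < i then ⟨j, by have := j.isLt; omega⟩
  else ⟨(j : ℕ) + 1, by have := j.isLt; omega⟩

open Classical in
/-- `φ_{(i;I)}` evaluated on the monomial of `P_{n-1}` with exponent vector `b`:
`(x_i^{2^r - 1} f_i(x)) / x_{(I,u)}` if `x` is `u`-compatible with `(i;I)` for some `u`,
and `0` otherwise.  Here `i` and the entries of `I` are 1-based variable labels. -/
def phiMon (n i : ℕ) (I : List ℕ) (b : Fin (n - 1) →₀ ℕ) : P n :=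
  if h : ∃ u, uCompat I u b then
    monomial (ev fun k : Fin n =>
      (if (k : ℕ) + 1 = i then 2 ^ I.length - 1 else 0) +
        Finsupp.mapDomain (fIdx n i) b k - xIuExp n I (Classical.choose h) k) 1
  else 0

/-- Exponent vector of `X^e = (x_1 ⋯ x_m)^e` in `P_m`. -/
def Xexp (m e : ℕ) : Fin m →₀ ℕ := ev fun _ => e

/-- `X_u^e = (Π_{j ≠ u} x_j)^e` in `P_n` (`u` 1-based). -/
def XjMon (n u e : ℕ) : P n := monomial (ev fun k : Fin n => if (k : ℕ) + 1 = u then 0 else e) 1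

/-- `x_u^e` in `P_n` (`u` 1-based). -/
def xvMon (n u e : ℕ) : P n := monomial (ev fun k : Fin n => if (k : ℕ) + 1 = u then e else 0) 1

/-- The weight vector `((n-1)^{(d)}, 1)` (zero-based indexing). -/
def wSpike (n d : ℕ) : ℕ → ℕ := fun i => if i < d then n - 1 else if i = d then 1 else 0

/-- Kameko's map `ψ : P_5 → P_5`, `x_1x_2x_3x_4x_5 · y^2 ↦ y` on monomials, `0` otherwise. -/
def psi : P 5 →ₗ[ZMod 2] P 5 :=
  (basisMonomials (Fin 5) (ZMod 2)).constr (ZMod 2) fun a =>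
    if ∀ j, Odd (a j) then monomial (Finsupp.mapRange (· / 2) (Nat.zero_div 2) a) 1 else 0

/-- The Σ₅-invariant subspace of a subspace `V` of `QP_5 = P_5 / A^+P_5`: classes in `V`
having a representative `f` with `[σ · f] = [f]` for all permutations `σ` of the variables. -/
def invSub (V : Submodule (ZMod 2) (P 5 ⧸ hitS 5)) : Submodule (ZMod 2) (P 5 ⧸ hitS 5) where
  carrier := {q | q ∈ V ∧ ∃ f : P 5, (hitS 5).mkQ f = q ∧
      ∀ σ : Equiv.Perm (Fin 5), (hitS 5).mkQ (rename (⇑σ) f) = q}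
  add_mem' := by
    rintro a b ⟨haV, f, hf, hfa⟩ ⟨hbV, g, hg, hgb⟩
    refine ⟨V.add_mem haV hbV, f + g, ?_, fun σ => ?_⟩
    · simp [map_add, hf, hg]
    · simp [map_add, hfa σ, hgb σ]
  zero_mem' := ⟨V.zero_mem, 0, by simp, fun σ => by simp⟩
  smul_mem' := by
    rintro c a ⟨haV, f, hf, hfa⟩
    refine ⟨V.smul_mem c haV, c • f, ?_, fun σ => ?_⟩
    · simp [map_smul, hf]
    · simp [map_smul, hfa σ]

/-- The maps `ρ_1, …, ρ_5` generating the action of `GL_5` on `P_5`: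
`ρ_i` (for `1 ≤ i ≤ 4`) swaps `x_i, x_{i+1}`; `ρ_5` sends `x_1 ↦ x_1 + x_2`. -/
def rho5 (i : ℕ) : P 5 → P 5 := fun f =>
  if i = 1 then rename (⇑(Equiv.swap (0 : Fin 5) 1)) f
  else if i = 2 then rename (⇑(Equiv.swap (1 : Fin 5) 2)) f
  else if i = 3 then rename (⇑(Equiv.swap (2 : Fin 5) 3)) f
  else if i = 4 then rename (⇑(Equiv.swap (3 : Fin 5) 4)) f
  else if i = 5 then MvPolynomial.aeval (R := ZMod 2)
    (fun j : Fin 5 => if j = 0 then X 0 + X 1 else X j) f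
  else f

/-- The action of an invertible matrix on `P_5` by linear substitution of the variables. -/
def glAct (g : Matrix (Fin 5) (Fin 5) (ZMod 2)) (f : P 5) : P 5 :=
  MvPolynomial.aeval (R := ZMod 2) (fun i : Fin 5 => ∑ j : Fin 5, g i j • X j) f

/-- The weight vector `(3,3,4)` (zero-based indexing). -/
def w334 : ℕ → ℕ := fun i => if i = 0 then 3 else if i = 1 then 3 else if i = 2 then 4 else 0

/-- The weight vector `(3,3,2,1)` (zero-based indexing). -/
def w3321 : ℕ → ℕ := fun i =>
  if i = 0 then 3 else if i = 1 then 3 else if i = 2 then 2 else if i = 3 then 1 else 0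

/-- The weight vector `(4,1,1)` (zero-based indexing). -/
def w411 : ℕ → ℕ := fun i => if i = 0 then 4 else if i = 1 then 1 else if i = 2 then 1 else 0

/-- `p_6 = x_1x_2x_3x_4x_5^6 + x_1x_2x_3x_4^6x_5 + x_1x_2x_3^6x_4x_5 + x_1x_2^6x_3x_4x_5
+ x_1^3x_2x_3x_4x_5^4 + x_1^3x_2x_3x_4^4x_5 + x_1^3x_2x_3^4x_4x_5 + x_1^3x_2^4x_3x_4x_5`. -/
def p6 : P 5 :=
  monomial (ev ![1,1,1,1,6]) 1 + monomial (ev ![1,1,1,6,1]) 1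
    + monomial (ev ![1,1,6,1,1]) 1 + monomial (ev ![1,6,1,1,1]) 1
    + monomial (ev ![3,1,1,1,4]) 1 + monomial (ev ![3,1,1,4,1]) 1
    + monomial (ev ![3,1,4,1,1]) 1 + monomial (ev ![3,4,1,1,1]) 1

def cc (a b : ℕ) : ℕ := if a ≤ b then a.choose (b - a) else 0

lemma cc_sum (a b : ℕ) :
    (∑ k ∈ Finset.range (a + 1), if a + k = b then ((a.choose k : ℕ) : ZMod 2) else 0)
      = ((cc a b : ℕ) : ZMod 2) := by
  unfold cc
  split_ifs with h
  · rw [Finset.sum_eq_single (b - a)]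
    · rw [if_pos (by omega)]
    · intro k _ hk; rw [if_neg (by omega)]
    · intro hk
      rw [if_pos (by omega), Nat.choose_eq_zero_of_lt (by simp at hk; omega)]; simp
  · rw [Finset.sum_eq_zero]
    · simp
    · intro k _; rw [if_neg (by omega)]

lemma sqTot_mon (n : ℕ) (a : Fin n →₀ ℕ) :
    sqTot n (monomial a 1) = ∑ k ∈ Fintype.piFinset (fun i => Finset.range (a i + 1)),
      monomial (ev fun i => a i + k i) (∏ i, (((a i).choose (k i) : ℕ) : ZMod 2)) := by
  unfold sqTot
  rw [bind₁_monomial, map_one, one_mul]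
  change (∏ i ∈ a.support, _) = _
  rw [Finset.prod_subset (Finset.subset_univ _)
    (by intro i _ hi; rw [Finsupp.notMem_support_iff.1 hi, pow_zero])]
  have h : ∀ i : Fin n, ((X i + X i ^ 2 : P n)) ^ (a i) =
      ∑ k ∈ Finset.range (a i + 1), C (((a i).choose k : ℕ) : ZMod 2) * X i ^ (a i + k) := by
    intro i
    rw [add_comm, add_pow]
    refine Finset.sum_congr rfl fun k hk => ?_
    have : k ≤ a i := by simpa [Nat.lt_succ_iff] using hk
    rw [← pow_mul, ← pow_add, mul_comm, map_natCast]
    congr 2; omega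
  rw [Finset.prod_congr rfl fun i _ => h i, Finset.prod_univ_sum]
  refine Finset.sum_congr rfl fun k _ => ?_
  rw [Finset.prod_mul_distrib, monomial_eq, map_prod]
  congr 1
  rw [Finsupp.prod_fintype _ _ (by simp)]
  rfl

lemma coeff_sqTot (n : ℕ) (a b : Fin n →₀ ℕ) :
    coeff b (sqTot n (monomial a 1)) = ∏ i, ((cc (a i) (b i) : ℕ) : ZMod 2) := by
  rw [sqTot_mon, coeff_sum]
  simp_rw [← cc_sum]
  rw [Finset.prod_univ_sum]
  refine Finset.sum_congr rfl fun k _ => ?_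
  rw [coeff_monomial]
  by_cases h : (ev fun i => a i + k i) = b
  · rw [if_pos h]
    refine Finset.prod_congr rfl fun i _ => ?_
    rw [if_pos]; rw [← h]; rfl
  · rw [if_neg h]
    have : ∃ i, a i + k i ≠ b i := by
      by_contra hc; push Not at hc; exact h (Finsupp.ext hc)
    obtain ⟨i, hi⟩ := this
    exact (Finset.prod_eq_zero (Finset.mem_univ i) (if_neg hi)).symm

lemma mdeg_eq {n : ℕ} (a : Fin n →₀ ℕ) : a.degree = mdeg a := by
  rw [Finsupp.degree_eq_sum]; rfl

lemma coeff_L (n d j : ℕ) (a b : Fin n →₀ ℕ) :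
    coeff b (homogeneousComponent (d + j) (sqTot n (monomial a 1))) =
      if mdeg b = d + j then ∏ i, ((cc (a i) (b i) : ℕ) : ZMod 2) else 0 := by
  rw [coeff_homogeneousComponent, coeff_sqTot, mdeg_eq]

lemma hc_mon (n d : ℕ) (a : Fin n →₀ ℕ) (c : ZMod 2) :
    homogeneousComponent d (monomial a c) = if mdeg a = d then monomial a c else 0 := by
  ext b
  rw [coeff_homogeneousComponent, mdeg_eq]
  by_cases h : a = b
  · subst h; split_ifs <;> simp
  · split_ifs <;> simp [coeff_monomial, h]

lemma SqK_mon (n j : ℕ) (a : Fin n →₀ ℕ) :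
    SqK n j (monomial a 1) = homogeneousComponent (mdeg a + j) (sqTot n (monomial a 1)) := by
  unfold SqK
  rw [Finset.sum_eq_single (mdeg a)]
  · rw [hc_mon, if_pos rfl]
  · intro d _ hd; rw [hc_mon, if_neg (Ne.symm hd)]; simp
  · intro h
    exfalso; apply h
    rw [totalDegree_monomial _ one_ne_zero, Finset.mem_range, ← mdeg_eq]
    change _ < a.degree + 1
    omega

/-- a linear functional killing all squares of monomials kills hits -/
lemma kills_hit (n : ℕ) (φ : P n →ₗ[ZMod 2] ZMod 2)
    (h : ∀ j, 1 ≤ j → ∀ a : Fin n →₀ ℕ, φ (SqK n j (monomial a 1)) = 0) :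
    hitS n ≤ LinearMap.ker φ := by
  refine Submodule.span_le.2 ?_
  rintro g ⟨j, hj, f, rfl⟩
  change φ _ = 0
  unfold SqK
  rw [map_sum]
  refine Finset.sum_eq_zero fun d _ => ?_
  have key : ∀ f : P n,
      φ (homogeneousComponent (d + j) (sqTot n (homogeneousComponent d f))) = 0 := by
    intro f
    induction f using MvPolynomial.induction_on' with
    | monomial a c =>
      rw [hc_mon]
      split_ifs with hd
      · have : (monomial a c : P n) = c • monomial a 1 := by simp [smul_monomial]
        rw [this, map_smul, map_smul, map_smul, ← hd, ← SqK_mon, h j hj, smul_zero]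
      · simp
    | add p q hp hq => rw [map_add, map_add, map_add, map_add, hp, hq, add_zero]
  exact key f

/-! weights -/
def w5 (b : Fin 5 → ℕ) (i : ℕ) : ℕ :=
  b 0 / 2 ^ i % 2 + b 1 / 2 ^ i % 2 + b 2 / 2 ^ i % 2 + b 3 / 2 ^ i % 2 + b 4 / 2 ^ i % 2
def d5 (b : Fin 5 → ℕ) : ℕ := b 0 + b 1 + b 2 + b 3 + b 4

def low (b : Fin 5 → ℕ) : Bool :=
  Nat.blt (w5 b 0) 4 || (Nat.beq (w5 b 0) 4 && (Nat.blt (w5 b 1) 1 ||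
    (Nat.beq (w5 b 1) 1 && Nat.blt (w5 b 2) 1)))

lemma wt_eq (b : Fin 5 →₀ ℕ) (i : ℕ) : wt b i = w5 b i := by
  unfold wt w5; rw [Fin.sum_univ_five]

lemma mdeg5 (b : Fin 5 →₀ ℕ) : mdeg b = d5 b := by
  unfold mdeg d5; rw [Fin.sum_univ_five]

lemma low_iff (b : Fin 5 →₀ ℕ) : lexLt (wt b) w411 ↔ low b = true := by
  have h0 : w411 0 = 4 := rfl
  have h1 : w411 1 = 1 := rfl
  have h2 : w411 2 = 1 := rfl
  have e : low b = true ↔ (wt b 0 < 4 ∨ (wt b 0 = 4 ∧ (wt b 1 < 1 ∨ (wt b 1 = 1 ∧ wt b 2 < 1)))) := by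
    simp only [low, wt_eq, Bool.or_eq_true, Bool.and_eq_true, Nat.blt_eq, Nat.beq_eq]
  rw [e]
  constructor
  · rintro ⟨i, hi, hl⟩
    match i, hi, hl with
    | 0, _, hl => left; rw [h0] at hl; exact hl
    | 1, hi, hl => 
      have := hi 0 (by omega); rw [h0] at this; rw [h1] at hl; omega
    | 2, hi, hl => 
      have := hi 0 (by omega); have := hi 1 (by omega); rw [h2] at hl; omega
    | (k+3), hi, hl => 
      have : w411 (k+3) = 0 := by simp [w411]
      omega
  · intro h
    by_cases a0 : wt b 0 < 4
    · exact ⟨0, by omega, by omega⟩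
    by_cases a1 : wt b 1 < 1
    · exact ⟨1, by intro j hj; obtain rfl : j = 0 := by omega
                   omega, by omega⟩
    · exact ⟨2, by intro j hj; obtain rfl | rfl : j = 0 ∨ j = 1 := by omega
                   all_goals omega, by omega⟩

lemma mem_PnLt_of (g : P 5) (h : ∀ b : Fin 5 →₀ ℕ, coeff b g ≠ 0 → mdeg b = 10 ∧ low b = true) :
    g ∈ PnLt 5 10 w411 := by
  rw [g.as_sum]
  refine Submodule.sum_mem _ fun b hb => ?_
  have := h b (mem_support_iff.1 hb)
  have e : (monomial b (coeff b g) : P 5) = coeff b g • monomial b 1 := by simp [smul_monomial]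
  rw [e]
  exact Submodule.smul_mem _ _ (Submodule.subset_span ⟨b, this.1, (low_iff b).2 this.2, rfl⟩)

/-! the monomials of weight `(4,1,1)`, and some of weight `(4,3)` -/
def mv (e i j : Fin 5) : Fin 5 → ℕ := fun k =>
  (if k = e then 0 else 1) + (if k = i then 2 else 0) + (if k = j then 4 else 0)

def nv (e i j : Fin 5) : Fin 5 → ℕ := fun k =>
  (if k = e then 2 else 1) + (if k = i then 2 else 0) + (if k = j then 2 else 0)

/-- all weight `(4,3)` monomials: two-bits at the three places outside `{i, j}` -/
def ov (e i j : Fin 5) : Fin 5 → ℕ := fun k =>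
  (if k = e then 0 else 1) + (if k = i ∨ k = j then 0 else 2)

def cp (a b : Fin 5 → ℕ) : ℕ :=
  cc (a 0) (b 0) * cc (a 1) (b 1) * cc (a 2) (b 2) * cc (a 3) (b 3) * cc (a 4) (b 4)

def pre (b : ℕ) : List ℕ := (List.range (b + 1)).filter fun a => cc a b % 2 == 1

def good (T : List (Fin 5 → ℕ)) : Bool :=
  T.all fun b => d5 b == 10 && !(low b) &&
    (pre (b 0)).all fun a0 => (pre (b 1)).all fun a1 => (pre (b 2)).all fun a2 =>
    (pre (b 3)).all fun a3 => (pre (b 4)).all fun a4 =>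
      a0 + a1 + a2 + a3 + a4 == 10 || (T.map (cp ![a0, a1, a2, a3, a4])).sum % 2 == 0

def phi (T : List (Fin 5 → ℕ)) : P 5 →ₗ[ZMod 2] ZMod 2 :=
  (T.map fun b => lcoeff (ZMod 2) (ev b)).sum

lemma phi_apply (T : List (Fin 5 → ℕ)) (f : P 5) :
    phi T f = (T.map fun b => coeff (ev b) f).sum := by
  unfold phi
  induction T with
  | nil => simp
  | cons b T ih => simp [ih]

lemma ev_coe (a : Fin 5 →₀ ℕ) : ev (a : Fin 5 → ℕ) = a := by ext; rfl

lemma cp_cast (a b : Fin 5 → ℕ) : ((cp a b : ℕ) : ZMod 2) = ∏ i, ((cc (a i) (b i) : ℕ) : ZMod 2) := by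
  rw [Fin.prod_univ_five]; unfold cp; push_cast; rfl

lemma mem_pre {a b : ℕ} (h : ((cc a b : ℕ) : ZMod 2) ≠ 0) : a ∈ pre b := by
  unfold pre
  rw [List.mem_filter, List.mem_range]
  constructor
  · by_contra hc
    apply h
    rw [cc, if_neg (by omega)]; rfl
  · have : ¬ (2 ∣ cc a b) := fun hd => h ((ZMod.natCast_eq_zero_iff _ _).2 hd)
    simp; omega

lemma good_kills (T : List (Fin 5 → ℕ)) (h : good T = true) :
    hitS 5 ⊔ PnLt 5 10 w411 ≤ LinearMap.ker (phi T) := by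
  unfold good at h
  rw [List.all_eq_true] at h
  refine sup_le (kills_hit 5 _ ?_) (Submodule.span_le.2 ?_)
  · intro j hj a
    rw [phi_apply, SqK_mon]
    by_cases hd : mdeg a + j = 10
    · have e1 : (T.map fun b => coeff (ev b)
          (homogeneousComponent (mdeg a + j) (sqTot 5 (monomial a 1)))).sum
          = (((T.map (cp a)).sum : ℕ) : ZMod 2) := by
        rw [Nat.cast_list_sum, List.map_map]
        congr 1
        refine List.map_congr_left fun b hb => ?_
        have hb' := h b hb
        simp only [Bool.and_eq_true, beq_iff_eq] at hb'
        rw [coeff_L, if_pos]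
        · rw [Function.comp, cp_cast]; rfl
        · rw [hd, mdeg5]; exact hb'.1.1
      rw [e1]
      by_contra hne
      have : ∃ b ∈ T, ((cp a b : ℕ) : ZMod 2) ≠ 0 := by
        by_contra hc
        push Not at hc
        apply hne
        rw [Nat.cast_list_sum, List.map_map]
        apply List.sum_eq_zero
        intro x hx
        obtain ⟨b, hb, rfl⟩ := List.mem_map.1 hx
        exact hc b hb
      obtain ⟨b, hb, hab⟩ := this
      rw [cp_cast] at hab
      have hab' : ∀ i, a i ∈ pre (b i) := fun i =>
        mem_pre (Finset.prod_ne_zero_iff.1 hab i (Finset.mem_univ i))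
      have hb' := h b hb
      simp only [Bool.and_eq_true, List.all_eq_true] at hb'
      have := hb'.2 _ (hab' 0) _ (hab' 1) _ (hab' 2) _ (hab' 3) _ (hab' 4)
      have ea : ![a 0, a 1, a 2, a 3, a 4] = (a : Fin 5 → ℕ) := by
        ext i; fin_cases i <;> rfl
      rw [ea] at this
      simp only [Bool.or_eq_true, beq_iff_eq] at this
      rcases this with h1 | h1
      · rw [mdeg5] at hd; unfold d5 at hd; omega
      · exact hne ((ZMod.natCast_eq_zero_iff _ _).2 (Nat.dvd_of_mod_eq_zero h1))
    · apply List.sum_eq_zero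
      intro x hx
      obtain ⟨b, hb, rfl⟩ := List.mem_map.1 hx
      have hb' := h b hb
      simp only [Bool.and_eq_true, beq_iff_eq] at hb'
      rw [coeff_L, if_neg]
      rw [mdeg5]; intro hx; apply hd; rw [← hx]; exact hb'.1.1
  · rintro g ⟨a, ha, hl, rfl⟩
    change phi T _ = 0
    rw [phi_apply]
    apply List.sum_eq_zero
    intro x hx
    obtain ⟨b, hb, rfl⟩ := List.mem_map.1 hx
    have hb' := h b hb
    simp only [Bool.and_eq_true, beq_iff_eq] at hb'
    rw [coeff_monomial, if_neg]
    intro hab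
    subst hab
    have := (low_iff _).1 hl
    have h2 := hb'.1.2
    change (!(low (ev b))) = true at h2
    rw [this] at h2
    exact absurd h2 (by decide)

def TS (e i j : Fin 5) : List (Fin 5 → ℕ) := if i = j then [mv e i j] else [mv e i j, mv e j i]

def TN (p j : Fin 5) : List (Fin 5 → ℕ) :=
  ((List.finRange 5).filter fun r => r ≠ p ∧ r ≠ j).map fun r => nv r p j

def TD (p j : Fin 5) : List (Fin 5 → ℕ) :=
  if p = j then [mv j j j] else [mv p p j, mv p j p] ++ TN p j

lemma good_TS : ∀ e i j : Fin 5, e ≠ i → e ≠ j → good (TS e i j) = true := by decide +kernel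

lemma good_TD : ∀ p q j : Fin 5, good (TD p j ++ TD q j) = true := by decide +kernel

/-! classification of the non-low monomials -/
def eqb (a b : Fin 5 → ℕ) : Bool :=
  Nat.beq (a 0) (b 0) && Nat.beq (a 1) (b 1) && Nat.beq (a 2) (b 2) && Nat.beq (a 3) (b 3)
   && Nat.beq (a 4) (b 4)

lemma eqb_iff (a b : Fin 5 → ℕ) : eqb a b = true ↔ a = b := by
  simp only [eqb, Bool.and_eq_true, Nat.beq_eq]
  constructor
  · rintro ⟨⟨⟨⟨h0, h1⟩, h2⟩, h3⟩, h4⟩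
    ext i; fin_cases i <;> assumption
  · rintro rfl; simp

def trip : List (Fin 5 × Fin 5 × Fin 5) :=
  [0, 1, 2, 3, 4].flatMap fun e => [0, 1, 2, 3, 4].flatMap fun i => [0, 1, 2, 3, 4].map fun j => (e, i, j)

lemma classify_aux :
    ((List.range 11).all fun b0 => (List.range (11 - b0)).all fun b1 =>
      (List.range (11 - b0 - b1)).all fun b2 => (List.range (11 - b0 - b1 - b2)).all fun b3 =>
      let b : Fin 5 → ℕ := ![b0, b1, b2, b3, 10 - b0 - b1 - b2 - b3]
      low b || trip.any (fun t => eqb (mv t.1 t.2.1 t.2.2) b) ||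
        (!(Nat.beq (w5 b 1) 1) && trip.any (fun t => eqb (ov t.1 t.2.1 t.2.2) b && t.2.1 ≠ t.2.2))) = true := by
  decide +kernel

lemma classify (b : Fin 5 →₀ ℕ) (hd : mdeg b = 10) (hl : low b = false) :
    (∃ e i j, (b : Fin 5 → ℕ) = mv e i j) ∨
      (w5 b 1 ≠ 1 ∧ ∃ e i j, i ≠ j ∧ (b : Fin 5 → ℕ) = ov e i j) := by
  have h := classify_aux
  rw [mdeg5, d5] at hd
  simp only [List.all_eq_true, List.mem_range] at h
  have h' := h (b 0) (by omega) (b 1) (by omega) (b 2) (by omega) (b 3) (by omega)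
  have ea : ![b 0, b 1, b 2, b 3, 10 - b 0 - b 1 - b 2 - b 3] = (b : Fin 5 → ℕ) := by
    ext i; fin_cases i <;> first | rfl | (simp; omega)
  rw [ea, hl] at h'
  simp only [Bool.or_eq_true, Bool.and_eq_true, List.any_eq_true, eqb_iff] at h'
  rcases h' with (h' | ⟨t, _, ht⟩) | ⟨h1, t, _, ht, hne⟩
  · exact absurd h' (by decide)
  · exact Or.inl ⟨_, _, _, ht.symm⟩
  · refine Or.inr ⟨?_, _, _, _, by simpa using hne, ht.symm⟩
    intro h2; rw [h2] at h1; exact absurd h1 (by decide)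

def U : Submodule (ZMod 2) (P 5) := hitS 5 ⊔ PnLt 5 10 w411

def mon (b : Fin 5 → ℕ) : P 5 := monomial (ev b) 1

lemma coeff_monL (L : List (Fin 5 → ℕ)) (b : Fin 5 →₀ ℕ) :
    coeff b (L.map mon).sum = ((L.countP (eqb b) : ℕ) : ZMod 2) := by
  induction L with
  | nil => simp
  | cons c L ih =>
    rw [List.map_cons, List.sum_cons, coeff_add, ih, List.countP_cons, mon, coeff_monomial]
    have : (ev c = b) ↔ eqb b c = true := by
      rw [eqb_iff]
      constructor
      · rintro rfl; rfl
      · intro h; rw [← h]; exact ev_coe b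
    simp only [this]
    split_ifs <;> push_cast <;> ring

lemma rel_gen (j : ℕ) (hj : 1 ≤ j) (a : Fin 5 → ℕ) (ha : d5 a + j = 10) (L : List (Fin 5 → ℕ))
    (hL : ∀ b ∈ L, d5 b = 10)
    (h1 : ∀ e i j, cp a (mv e i j) % 2 = L.countP (eqb (mv e i j)) % 2)
    (h2 : ∀ e i j, i ≠ j → cp a (ov e i j) % 2 = L.countP (eqb (ov e i j)) % 2) :
    (L.map mon).sum ∈ U := by
  have key : SqK 5 j (mon a) + (L.map mon).sum ∈ PnLt 5 10 w411 := by
    apply mem_PnLt_of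
    intro b hb
    rw [coeff_add, mon, SqK_mon, coeff_L, coeff_monL, mdeg5 (ev a)] at hb
    have ha' : d5 (ev a) + j = 10 := ha
    rw [ha', ← cp_cast] at hb
    have hdeg : mdeg b = 10 := by
      by_contra hc
      rw [if_neg hc, zero_add] at hb
      apply hb
      rw [List.countP_eq_zero.2]; · rfl
      intro c hc' hbc
      rw [eqb_iff] at hbc
      apply hc; rw [mdeg5, hbc]; exact hL c hc'
    refine ⟨hdeg, ?_⟩
    rw [if_pos hdeg] at hb
    by_contra hl
    apply hb
    have : cp (ev a) b % 2 = L.countP (eqb b) % 2 := by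
      rcases classify b hdeg (by simpa using hl) with ⟨e, i, k, h⟩ | ⟨_, e, i, k, hik, h⟩
      · rw [h]; exact h1 e i k
      · rw [h]; exact h2 e i k hik
    rw [← Nat.cast_add]
    exact (ZMod.natCast_eq_zero_iff _ _).2 (by omega)
  have h3 : SqK 5 j (mon a) ∈ U :=
    Submodule.mem_sup_left (Submodule.subset_span ⟨j, hj, _, rfl⟩)
  have h4 := U.sub_mem (Submodule.mem_sup_right key : _ ∈ U) h3
  rwa [add_sub_cancel_left] at h4

def av (e i j : Fin 5) : Fin 5 → ℕ := fun k =>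
  (if k = e then 0 else 1) + (if k = i then 2 else 0) + (if k = j then 2 else 0)

def aw (j : Fin 5) : Fin 5 → ℕ := fun k => 1 + (if k = j then 4 else 0)

def LR (j : Fin 5) : List (Fin 5 → ℕ) := [mv 0 0 j, mv 1 1 j, mv 2 2 j, mv 3 3 j, mv 4 4 j]

lemma chk1 : (trip.all fun s => s.2.1 = s.2.2 || (trip.all fun t =>
    Nat.beq (cp (av s.1 s.2.1 s.2.2) (mv t.1 t.2.1 t.2.2) % 2)
      ([mv s.1 s.2.1 s.2.2, mv s.1 s.2.2 s.2.1].countP (eqb (mv t.1 t.2.1 t.2.2)) % 2) &&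
    (t.2.1 = t.2.2 || Nat.beq (cp (av s.1 s.2.1 s.2.2) (ov t.1 t.2.1 t.2.2) % 2)
      ([mv s.1 s.2.1 s.2.2, mv s.1 s.2.2 s.2.1].countP (eqb (ov t.1 t.2.1 t.2.2)) % 2)))) = true := by
  decide +kernel

lemma chk2 : ∀ j : Fin 5, (trip.all fun t =>
    Nat.beq (cp (aw j) (mv t.1 t.2.1 t.2.2) % 2)
      ((LR j).countP (eqb (mv t.1 t.2.1 t.2.2)) % 2) &&
    (t.2.1 = t.2.2 || Nat.beq (cp (aw j) (ov t.1 t.2.1 t.2.2) % 2)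
      ((LR j).countP (eqb (ov t.1 t.2.1 t.2.2)) % 2))) = true := by
  decide +kernel

lemma mem_trip : ∀ e i j : Fin 5, (e, i, j) ∈ trip := by decide +kernel

lemma deg_mv : ∀ e i j : Fin 5, d5 (mv e i j) = 10 := by decide +kernel

lemma rel1 (e i j : Fin 5) (hij : i ≠ j) : mon (mv e i j) + mon (mv e j i) ∈ U := by
  have h := List.all_eq_true.1 chk1 _ (mem_trip e i j)
  simp only [hij, decide_false, Bool.false_or, List.all_eq_true, Bool.and_eq_true, Nat.beq_eq,
    Bool.or_eq_true, decide_eq_true_eq] at h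
  have := rel_gen 2 (by norm_num) (av e i j)
    (by clear h; revert e i j; decide +kernel) [mv e i j, mv e j i]
    (by simp [deg_mv])
    (fun e' i' j' => (h _ (mem_trip e' i' j')).1)
    (fun e' i' j' hn => (h _ (mem_trip e' i' j')).2.resolve_left hn)
  simpa using this

lemma rel2 (j : Fin 5) : mon (mv 0 0 j) + mon (mv 1 1 j) + mon (mv 2 2 j) + mon (mv 3 3 j)
    + mon (mv 4 4 j) ∈ U := by
  have h := List.all_eq_true.1 (chk2 j)
  simp only [Bool.and_eq_true, Nat.beq_eq,
    Bool.or_eq_true, decide_eq_true_eq] at h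
  have := rel_gen 1 (by norm_num) (aw j)
    (by clear h; revert j; decide +kernel) (LR j)
    (by simp [LR, deg_mv])
    (fun e' i' j' => (h _ (mem_trip e' i' j')).1)
    (fun e' i' j' hn => (h _ (mem_trip e' i' j')).2.resolve_left hn)
  simpa [LR, add_assoc] using this

lemma inj_aux : (trip.all fun s => trip.all fun t =>
    !(eqb (mv s.1 s.2.1 s.2.2) (mv t.1 t.2.1 t.2.2)) || s = t) = true := by decide +kernel

lemma mv_inj {e i j e' i' j' : Fin 5} (h : mv e i j = mv e' i' j') : e = e' ∧ i = i' ∧ j = j' := by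
  have h1 := List.all_eq_true.1 (List.all_eq_true.1 inj_aux _ (mem_trip e i j)) _ (mem_trip e' i' j')
  simpa [(eqb_iff _ _).2 h] using h1

lemma low_mv : ∀ e i j : Fin 5, low (mv e i j) = false := by decide +kernel
lemma low_nv : ∀ r p j : Fin 5, r ≠ p → r ≠ j → p ≠ j →
    low (nv r p j) = false ∧ w5 (nv r p j) 1 = 3 := by decide +kernel

lemma ev_inj {a b : Fin 5 → ℕ} (h : ev a = ev b) : a = b := by
  simpa [ev] using h

def cf (f : P 5) (e i j : Fin 5) : ZMod 2 := coeff (ev (mv e i j)) f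

lemma lt_irr : ¬ lexLt w411 w411 := by
  rintro ⟨i, _, h⟩; exact lt_irrefl _ h

lemma PnLe_gen {b : Fin 5 →₀ ℕ} (hd : mdeg b = 10) (h : wt b = w411) :
    ∃ e i j, b = ev (mv e i j) := by
  have hl : low b = false := by
    by_contra hc
    have := (low_iff b).2 (by simpa using hc)
    rw [h] at this; exact lt_irr this
  rcases classify b hd hl with ⟨e, i, j, h'⟩ | ⟨h', _⟩
  · exact ⟨e, i, j, by rw [← h', ev_coe]⟩
  · exfalso; apply h'; rw [← wt_eq, h]; rfl

lemma psi_expand (ψ : P 5 →ₗ[ZMod 2] ZMod 2) (hψ : U ≤ LinearMap.ker ψ) (f : P 5)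
    (hf : f ∈ PnLe 5 10 w411) :
    ψ f = ∑ e, ∑ i, ∑ j, cf f e i j * ψ (mon (mv e i j)) := by
  induction hf using Submodule.span_induction with
  | mem f h =>
    obtain ⟨b, hd, hle, rfl⟩ := h
    rcases hle with h | h
    · obtain ⟨e, i, j, rfl⟩ := PnLe_gen hd h
      have key : ∀ e' i' j', cf (monomial (ev (mv e i j)) 1) e' i' j' =
          if e' = e ∧ i' = i ∧ j' = j then 1 else 0 := by
        intro e' i' j'
        rw [cf, coeff_monomial]
        refine if_congr ⟨fun h => ?_, ?_⟩ rfl rfl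
        · obtain ⟨rfl, rfl, rfl⟩ := mv_inj (ev_inj h); simp
        · rintro ⟨rfl, rfl, rfl⟩; rfl
      rw [Finset.sum_eq_single e, Finset.sum_eq_single i, Finset.sum_eq_single j]
      · simp [key, mon]
      · intro x _ hx; simp [key, hx]
      · simp
      · intro x _ hx; simp [key, hx]
      · simp
      · intro x _ hx; simp [key, hx]
      · simp
    · have : ψ (monomial b 1) = 0 :=
        hψ (Submodule.mem_sup_right (Submodule.subset_span ⟨b, hd, h, rfl⟩))
      rw [this]
      symm
      refine Finset.sum_eq_zero fun e _ => Finset.sum_eq_zero fun i _ => Finset.sum_eq_zero fun j _ => ?_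
      rw [cf, coeff_monomial, if_neg, zero_mul]
      rintro rfl
      have h1 := (low_iff _).1 h
      have h2 := low_mv e i j
      exact absurd (h1.symm.trans h2) (by decide)
  | zero => simp [cf]
  | add f g _ _ hf hg =>
    rw [map_add, hf, hg]
    simp only [cf, coeff_add, add_mul, Finset.sum_add_distrib]
  | smul a f _ hf =>
    rw [map_smul, hf]
    simp only [cf, coeff_smul, smul_eq_mul, mul_assoc, Finset.mul_sum]

lemma nv_zero (f : P 5) (hf : f ∈ PnLe 5 10 w411) (r p j : Fin 5) (h1 : r ≠ p) (h2 : r ≠ j)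
    (h3 : p ≠ j) : coeff (ev (nv r p j)) f = 0 := by
  induction hf using Submodule.span_induction with
  | mem f h =>
    obtain ⟨b, hd, hle, rfl⟩ := h
    rw [coeff_monomial, if_neg]
    rintro rfl
    obtain ⟨k1, k2⟩ := low_nv r p j h1 h2 h3
    rcases hle with h | h
    · have := congrFun h 1
      rw [wt_eq] at this
      have h5 : w5 (nv r p j) 1 = 1 := this
      omega
    · have h4 := (low_iff _).1 h
      exact absurd (h4.symm.trans k1) (by decide)
  | zero => simp
  | add f g _ _ hf hg => rw [coeff_add, hf, hg, add_zero]
  | smul a f _ hf => rw [coeff_smul, hf, smul_zero]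

lemma sum_one (e : Fin 5) (g : Fin 5 → Fin 5 → ZMod 2) (D : Fin 5 → ZMod 2)
    (h1 : ∀ i, i ≠ e → g i i = 0) (h2 : ∀ i j, i ≠ e → j ≠ e → i ≠ j → g i j + g j i = 0)
    (h3 : ∀ j, j ≠ e → g e j + g j e = D j) (h4 : g e e = D e) :
    ∑ i, ∑ j, g i j = ∑ j, D j := by
  simp only [Fin.sum_univ_five]
  fin_cases e <;> simp only [Fin.zero_eta, Fin.mk_one, Fin.reduceFinMk] at *
  · linear_combination h4 + h1 1 (by decide) + h1 2 (by decide) + h1 3 (by decide) + h1 4 (by decide) + h2 1 2 (by decide) (by decide) (by decide) + h2 1 3 (by decide) (by decide) (by decide) + h2 1 4 (by decide) (by decide) (by decide) + h2 2 3 (by decide) (by decide) (by decide) + h2 2 4 (by decide) (by decide) (by decide) + h2 3 4 (by decide) (by decide) (by decide) + h3 1 (by decide) + h3 2 (by decide) + h3 3 (by decide) + h3 4 (by decide)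
  · linear_combination h4 + h1 0 (by decide) + h1 2 (by decide) + h1 3 (by decide) + h1 4 (by decide) + h2 0 2 (by decide) (by decide) (by decide) + h2 0 3 (by decide) (by decide) (by decide) + h2 0 4 (by decide) (by decide) (by decide) + h2 2 3 (by decide) (by decide) (by decide) + h2 2 4 (by decide) (by decide) (by decide) + h2 3 4 (by decide) (by decide) (by decide) + h3 0 (by decide) + h3 2 (by decide) + h3 3 (by decide) + h3 4 (by decide)
  · linear_combination h4 + h1 0 (by decide) + h1 1 (by decide) + h1 3 (by decide) + h1 4 (by decide) + h2 0 1 (by decide) (by decide) (by decide) + h2 0 3 (by decide) (by decide) (by decide) + h2 0 4 (by decide) (by decide) (by decide) + h2 1 3 (by decide) (by decide) (by decide) + h2 1 4 (by decide) (by decide) (by decide) + h2 3 4 (by decide) (by decide) (by decide) + h3 0 (by decide) + h3 1 (by decide) + h3 3 (by decide) + h3 4 (by decide)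
  · linear_combination h4 + h1 0 (by decide) + h1 1 (by decide) + h1 2 (by decide) + h1 4 (by decide) + h2 0 1 (by decide) (by decide) (by decide) + h2 0 2 (by decide) (by decide) (by decide) + h2 0 4 (by decide) (by decide) (by decide) + h2 1 2 (by decide) (by decide) (by decide) + h2 1 4 (by decide) (by decide) (by decide) + h2 2 4 (by decide) (by decide) (by decide) + h3 0 (by decide) + h3 1 (by decide) + h3 2 (by decide) + h3 4 (by decide)
  · linear_combination h4 + h1 0 (by decide) + h1 1 (by decide) + h1 2 (by decide) + h1 3 (by decide) + h2 0 1 (by decide) (by decide) (by decide) + h2 0 2 (by decide) (by decide) (by decide) + h2 0 3 (by decide) (by decide) (by decide) + h2 1 2 (by decide) (by decide) (by decide) + h2 1 3 (by decide) (by decide) (by decide) + h2 2 3 (by decide) (by decide) (by decide) + h3 0 (by decide) + h3 1 (by decide) + h3 2 (by decide) + h3 3 (by decide)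

def sV (f : P 5) (e i j : Fin 5) : ZMod 2 := if i = j then cf f e i j else cf f e i j + cf f e j i
def dV (f : P 5) (p j : Fin 5) : ZMod 2 := if p = j then cf f j j j else cf f p p j + cf f p j p

lemma add_eq_zero2 {a b : ZMod 2} (h : a + b = 0) : a = b := by
  revert a b; decide

lemma mem_U (f : P 5) (hf : f ∈ PnLe 5 10 w411)
    (hS : ∀ e i j, e ≠ i → e ≠ j → sV f e i j = 0)
    (hD : ∀ p q j, dV f p j = dV f q j) : f ∈ U := by
  by_contra hn
  obtain ⟨ψ, h1, h2⟩ := Submodule.exists_le_ker_of_notMem hn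
  apply h1
  rw [psi_expand ψ h2 f hf]
  have q1 : ∀ e i j, ψ (mon (mv e i j)) = ψ (mon (mv e j i)) := by
    intro e i j
    by_cases hij : i = j
    · rw [hij]
    · apply add_eq_zero2
      rw [← map_add]; exact h2 (rel1 e i j hij)
  have q2 : ∀ j, ∑ p, ψ (mon (mv p p j)) = 0 := by
    intro j
    rw [Fin.sum_univ_five, ← map_add, ← map_add, ← map_add, ← map_add]; exact h2 (rel2 j)
  have hs : ∀ e, ∑ i, ∑ j, cf f e i j * ψ (mon (mv e i j))
      = ∑ j, dV f 0 j * ψ (mon (mv e e j)) := by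
    intro e
    apply sum_one e
    · intro i hi
      have := hS e i i hi.symm hi.symm
      rw [sV, if_pos rfl] at this
      rw [this, zero_mul]
    · intro i j hi hj hij
      have := hS e i j hi.symm hj.symm
      rw [sV, if_neg hij] at this
      rw [q1 e j i, ← add_mul, this, zero_mul]
    · intro j hj
      rw [hD 0 e j, dV, if_neg hj.symm, q1 e j e]; ring
    · rw [hD 0 e e, dV, if_pos rfl]
  rw [Finset.sum_congr rfl fun e _ => hs e, Finset.sum_comm]
  refine Finset.sum_eq_zero fun j _ => ?_
  rw [← Finset.mul_sum, q2, mul_zero]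

lemma S_of_U (g : P 5) (hg : g ∈ U) (e i j : Fin 5) (h1 : e ≠ i) (h2 : e ≠ j) : sV g e i j = 0 := by
  have h : phi (TS e i j) g = 0 := good_kills _ (good_TS e i j h1 h2) hg
  rw [phi_apply] at h
  unfold TS at h
  unfold sV cf
  split_ifs at h ⊢ <;> simpa using h

def ZZ (g : P 5) : Prop := ∀ r p j : Fin 5, r ≠ p → r ≠ j → p ≠ j → coeff (ev (nv r p j)) g = 0

lemma phi_TD (g : P 5) (hz : ZZ g) (p j : Fin 5) :
    ((TD p j).map fun b => coeff (ev b) g).sum = dV g p j := by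
  unfold TD dV
  split_ifs with h
  · simp [cf]
  · rw [List.map_append, List.sum_append]
    have : ((TN p j).map fun b => coeff (ev b) g).sum = 0 := by
      apply List.sum_eq_zero
      intro x hx
      simp only [TN, List.mem_map, List.mem_filter] at hx
      obtain ⟨b, ⟨r, ⟨_, hr⟩, rfl⟩, rfl⟩ := hx
      simp only [decide_eq_true_eq] at hr
      exact hz r p j hr.1 hr.2 h
    rw [this]
    simp [cf]

lemma D_of_U (g : P 5) (hg : g ∈ U) (hz : ZZ g) (p q j : Fin 5) : dV g p j + dV g q j = 0 := by
  have h : phi (TD p j ++ TD q j) g = 0 := good_kills _ (good_TD p q j) hg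
  rw [phi_apply, List.map_append, List.sum_append, phi_TD g hz, phi_TD g hz] at h
  exact h

lemma mv_perm (σ : Equiv.Perm (Fin 5)) (e i j : Fin 5) :
    ev (mv (σ e) (σ i) (σ j)) = Finsupp.mapDomain σ (ev (mv e i j)) := by
  ext k
  rw [Finsupp.mapDomain_equiv_apply]
  obtain ⟨k, rfl⟩ := σ.surjective k
  simp [ev, mv]

lemma nv_perm (σ : Equiv.Perm (Fin 5)) (e i j : Fin 5) :
    ev (nv (σ e) (σ i) (σ j)) = Finsupp.mapDomain σ (ev (nv e i j)) := by
  ext k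
  rw [Finsupp.mapDomain_equiv_apply]
  obtain ⟨k, rfl⟩ := σ.surjective k
  simp [ev, nv]

lemma cf_perm (σ : Equiv.Perm (Fin 5)) (f : P 5) (e i j : Fin 5) :
    cf (rename σ f) (σ e) (σ i) (σ j) = cf f e i j := by
  rw [cf, mv_perm, coeff_rename_mapDomain _ σ.injective]; rfl

lemma ZZ_perm (σ : Equiv.Perm (Fin 5)) (f : P 5) (hz : ZZ f) : ZZ (rename σ f) := by
  intro r p j h1 h2 h3
  obtain ⟨r, rfl⟩ := σ.surjective r
  obtain ⟨p, rfl⟩ := σ.surjective p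
  obtain ⟨j, rfl⟩ := σ.surjective j
  rw [nv_perm, coeff_rename_mapDomain _ σ.injective]
  exact hz _ _ _ (fun h => h1 (by rw [h])) (fun h => h2 (by rw [h])) (fun h => h3 (by rw [h]))

lemma sV_perm (σ : Equiv.Perm (Fin 5)) (f : P 5) (e i j : Fin 5) :
    sV (rename σ f) (σ e) (σ i) (σ j) = sV f e i j := by
  simp only [sV, cf_perm, σ.injective.eq_iff]

lemma dV_perm (σ : Equiv.Perm (Fin 5)) (f : P 5) (p j : Fin 5) :
    dV (rename σ f) (σ p) (σ j) = dV f p j := by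
  simp only [dV, cf_perm, σ.injective.eq_iff]

lemma cf_add (f g : P 5) (e i j : Fin 5) : cf (f + g) e i j = cf f e i j + cf g e i j := coeff_add _ _ _

lemma sV_add (f g : P 5) (e i j : Fin 5) : sV (f + g) e i j = sV f e i j + sV g e i j := by
  simp only [sV, cf_add]; split_ifs <;> ring

lemma dV_add (f g : P 5) (p j : Fin 5) : dV (f + g) p j = dV f p j + dV g p j := by
  simp only [dV, cf_add]; split_ifs <;> ring

def InvP (f : P 5) (σ : Equiv.Perm (Fin 5)) : Prop :=
  (∀ e i j, e ≠ i → e ≠ j → sV f (σ e) (σ i) (σ j) = sV f e i j) ∧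
  ∀ p q j, dV f (σ p) (σ j) + dV f (σ q) (σ j) = dV f p j + dV f q j

lemma ZZ_add {f g : P 5} (hf : ZZ f) (hg : ZZ g) : ZZ (f + g) := by
  intro r p j h1 h2 h3
  rw [coeff_add, hf r p j h1 h2 h3, hg r p j h1 h2 h3, add_zero]

lemma inv_of (f : P 5) (hz : ZZ f) (σ : Equiv.Perm (Fin 5)) (h : rename σ f + f ∈ U) : InvP f σ := by
  constructor
  · intro e i j h1 h2
    have := S_of_U _ h (σ e) (σ i) (σ j) (fun h => h1 (σ.injective h)) (fun h => h2 (σ.injective h))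
    rw [sV_add, sV_perm] at this
    exact (add_eq_zero2 this).symm
  · intro p q j
    have := D_of_U _ h (ZZ_add (ZZ_perm σ f hz) hz) (σ p) (σ q) (σ j)
    rw [dV_add, dV_perm, dV_add, dV_perm] at this
    symm
    apply add_eq_zero2
    rw [← this]; ring

lemma inv_all (f : P 5) (h : ∀ i : Fin 4, InvP f (Equiv.swap i.castSucc i.succ))
    (σ : Equiv.Perm (Fin 5)) : InvP f σ := by
  have hσ : σ ∈ Submonoid.closure (Set.range fun i : Fin 4 ↦ Equiv.swap i.castSucc i.succ) := by
    rw [Equiv.Perm.mclosure_swap_castSucc_succ]; trivial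
  induction hσ using Submonoid.closure_induction with
  | mem x hx => obtain ⟨i, rfl⟩ := hx; exact h i
  | one => exact ⟨fun _ _ _ _ _ => rfl, fun _ _ _ => rfl⟩
  | mul x y _ _ hx hy =>
    constructor
    · intro e i j h1 h2
      simp only [Equiv.Perm.mul_apply]
      rw [hx.1 _ _ _ (fun h => h1 (y.injective h)) (fun h => h2 (y.injective h)), hy.1 _ _ _ h1 h2]
    · intro p q j
      simp only [Equiv.Perm.mul_apply]
      rw [hx.2, hy.2]

lemma tr3 : ∀ e i j : Fin 5, e ≠ i → e ≠ j → i ≠ j →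
    ∃ σ : Equiv.Perm (Fin 5), σ 0 = e ∧ σ 1 = i ∧ σ 2 = j := by
  intro e i j
  refine fun h1 h2 h3 => ⟨Equiv.swap 0 e * Equiv.swap 1 (Equiv.swap 0 e i) *
    Equiv.swap 2 (Equiv.swap 1 (Equiv.swap 0 e i) (Equiv.swap 0 e j)), ?_⟩
  revert e i j
  decide +kernel

lemma tr2 : ∀ e i : Fin 5, e ≠ i → ∃ σ : Equiv.Perm (Fin 5), σ 0 = e ∧ σ 1 = i := by
  intro e i h
  obtain ⟨j, h1, h2⟩ : ∃ j, e ≠ j ∧ i ≠ j := by revert e i; decide +kernel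
  obtain ⟨σ, a, b, _⟩ := tr3 e i j h h1 h2
  exact ⟨σ, a, b⟩

lemma z2c {a b c : ZMod 2} (h1 : a + b = a + c) (h2 : a + c = b + c) : a = b := by
  revert a b c; decide

lemma d_const (f : P 5) (h : ∀ σ, InvP f σ) (p q j : Fin 5) (h1 : p ≠ j) (h2 : q ≠ j) :
    dV f p j = dV f q j := by
  by_cases hpq : p = q
  · rw [hpq]
  obtain ⟨r, r1, r2, r3⟩ : ∃ r, r ≠ p ∧ r ≠ q ∧ r ≠ j := by
    clear hpq; revert p q j; decide +kernel
  have a := (h (Equiv.swap q r)).2 p q j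
  have b := (h (Equiv.swap p q)).2 p r j
  rw [Equiv.swap_apply_of_ne_of_ne hpq r1.symm, Equiv.swap_apply_left,
    Equiv.swap_apply_of_ne_of_ne h2.symm r3.symm] at a
  rw [Equiv.swap_apply_of_ne_of_ne r1 r2, Equiv.swap_apply_left,
    Equiv.swap_apply_of_ne_of_ne h1.symm h2.symm] at b
  exact z2c a.symm b.symm

/-! the map `ρ₅` -/
def r5 : P 5 →ₐ[ZMod 2] P 5 := MvPolynomial.aeval (R := ZMod 2)
    (fun j : Fin 5 => if j = 0 then X 0 + X 1 else X j)

lemma mono_X (a : Fin 5 → ℕ) (r : ZMod 2) : (monomial (ev a) r : P 5) =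
    C r * (X 0 ^ a 0 * X 1 ^ a 1 * X 2 ^ a 2 * X 3 ^ a 3 * X 4 ^ a 4) := by
  rw [monomial_eq, Finsupp.prod_fintype _ _ (by simp), Fin.prod_univ_five]; rfl

lemma r5_mono (a : Fin 5 → ℕ) (r : ZMod 2) : r5 (monomial (ev a) r) =
    C r * ((X 0 + X 1) ^ a 0 * X 1 ^ a 1 * X 2 ^ a 2 * X 3 ^ a 3 * X 4 ^ a 4) := by
  rw [mono_X]
  simp [r5, algebraMap_eq]

lemma r5_mono' (a : Fin 5 → ℕ) (r : ZMod 2) : r5 (monomial (ev a) r) =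
    ∑ k ∈ Finset.range (a 0 + 1),
      monomial (ev ![k, a 0 - k + a 1, a 2, a 3, a 4]) (r * ((a 0).choose k : ℕ)) := by
  rw [r5_mono, add_pow, Finset.sum_mul, Finset.sum_mul, Finset.sum_mul, Finset.sum_mul, Finset.mul_sum]
  refine Finset.sum_congr rfl fun k _ => ?_
  rw [mono_X, C_mul, map_natCast]
  simp only [Matrix.cons_val, pow_add]
  ring

lemma coeff_r5 (f : P 5) (b1 b2 b3 b4 : ℕ) :
    coeff (ev ![0, b1, b2, b3, b4]) (r5 f) =
      ∑ k ∈ Finset.range (b1 + 1), coeff (ev ![k, b1 - k, b2, b3, b4]) f := by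
  induction f using MvPolynomial.induction_on' with
  | monomial a r =>
    rw [← ev_coe a, r5_mono', coeff_sum, Finset.sum_eq_single 0]
    · simp only [coeff_monomial, Nat.choose_zero_right, Nat.cast_one, mul_one]
      have e1 : ∀ u v : Fin 5 → ℕ, ev u = ev v ↔
          (u 0 = v 0 ∧ u 1 = v 1 ∧ u 2 = v 2 ∧ u 3 = v 3 ∧ u 4 = v 4) := by
        intro u v
        constructor
        · intro h; rw [ev_inj h]; simp
        · rintro ⟨h0, h1, h2, h3, h4⟩
          congr 1; ext i; fin_cases i <;> assumption
      simp only [e1, Matrix.cons_val]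
      by_cases hc : a 0 + a 1 = b1 ∧ a 2 = b2 ∧ a 3 = b3 ∧ a 4 = b4
      · rw [if_pos (by simpa using hc), Finset.sum_eq_single (a 0)]
        · rw [if_pos]; omega
        · intro k _ hk; rw [if_neg]; omega
        · intro hk; simp at hk; omega
      · rw [if_neg (by simpa using hc), Finset.sum_eq_zero]
        intro k hk
        simp at hk
        rw [if_neg]; omega
    · intro k _ hk
      rw [coeff_monomial, if_neg]
      intro h
      exact hk (congrFun (ev_inj h) 0)
    · simp
  | add p q hp hq => simp only [map_add, coeff_add, hp, hq, Finset.sum_add_distrib]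

lemma cfv (f : P 5) (v : Fin 5 → ℕ) (e i j : Fin 5) (h : eqb v (mv e i j) = true) :
    coeff (ev v) f = cf f e i j := by rw [(eqb_iff _ _).1 h]; rfl

lemma cfn (f : P 5) (hz : ZZ f) (v : Fin 5 → ℕ) (r p j : Fin 5) (h : eqb v (nv r p j) = true)
    (h1 : r ≠ p) (h2 : r ≠ j) (h3 : p ≠ j) :
    coeff (ev v) f = 0 := by rw [(eqb_iff _ _).1 h]; exact hz r p j h1 h2 h3

lemma rho_B (f : P 5) (h : r5 f + f ∈ U) :
    sV f 1 0 0 + (dV f 0 0 + dV f 1 0) + (dV f 0 1 + dV f 1 1) = 0 := by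
  have h1 := S_of_U _ h 0 1 1 (by decide) (by decide)
  rw [sV_add] at h1
  have e : mv 0 1 1 = ![0, 7, 1, 1, 1] := (eqb_iff _ _).1 (by decide)
  have h2 : sV (r5 f) 0 1 1 = coeff (ev ![0, 7, 1, 1, 1]) (r5 f) := by
    rw [sV, if_pos rfl, cf, e]
  rw [h2, coeff_r5] at h1
  simp only [Finset.sum_range_succ, Finset.sum_range_zero, Nat.reduceSub, zero_add] at h1
  rw [cfv f ![0, 7, 1, 1, 1] 0 1 1 (by decide), cfv f ![1, 6, 1, 1, 1] 1 1 1 (by decide),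
    cfv f ![2, 5, 1, 1, 1] 0 0 1 (by decide), cfv f ![3, 4, 1, 1, 1] 1 0 1 (by decide),
    cfv f ![4, 3, 1, 1, 1] 0 1 0 (by decide), cfv f ![5, 2, 1, 1, 1] 1 1 0 (by decide),
    cfv f ![6, 1, 1, 1, 1] 0 0 0 (by decide), cfv f ![7, 0, 1, 1, 1] 1 0 0 (by decide)] at h1
  simp only [sV, dV, if_true, if_false, Fin.reduceEq, zero_ne_one, one_ne_zero] at h1 ⊢
  have h2 : (2 : ZMod 2) = 0 := rfl
  linear_combination h1 - cf f 0 1 1 * h2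

lemma rho_A (f : P 5) (hz : ZZ f) (h : r5 f + f ∈ U) :
    sV f 1 0 2 + (dV f 0 2 + dV f 1 2) = 0 := by
  have h1 := S_of_U _ h 0 1 2 (by decide) (by decide)
  rw [sV_add] at h1
  have e : mv 0 1 2 = ![0, 3, 5, 1, 1] := (eqb_iff _ _).1 (by decide)
  have e' : mv 0 2 1 = ![0, 5, 3, 1, 1] := (eqb_iff _ _).1 (by decide)
  have h2 : sV (r5 f) 0 1 2 = coeff (ev ![0, 3, 5, 1, 1]) (r5 f)
      + coeff (ev ![0, 5, 3, 1, 1]) (r5 f) := by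
    rw [sV, if_neg (by decide), cf, cf, e, e']
  rw [h2, coeff_r5, coeff_r5] at h1
  simp only [Finset.sum_range_succ, Finset.sum_range_zero, Nat.reduceSub, zero_add] at h1
  rw [cfv f ![0, 3, 5, 1, 1] 0 1 2 (by decide), cfv f ![1, 2, 5, 1, 1] 1 1 2 (by decide),
    cfv f ![2, 1, 5, 1, 1] 0 0 2 (by decide), cfv f ![3, 0, 5, 1, 1] 1 0 2 (by decide),
    cfv f ![0, 5, 3, 1, 1] 0 2 1 (by decide), cfv f ![1, 4, 3, 1, 1] 1 2 1 (by decide),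
    cfn f hz ![2, 3, 3, 1, 1] 0 1 2 (by decide) (by decide) (by decide) (by decide),
    cfn f hz ![3, 2, 3, 1, 1] 1 0 2 (by decide) (by decide) (by decide) (by decide),
    cfv f ![4, 1, 3, 1, 1] 0 2 0 (by decide), cfv f ![5, 0, 3, 1, 1] 1 2 0 (by decide)] at h1
  simp only [sV, dV, if_false, Fin.reduceEq] at h1 ⊢
  have h2 : (2 : ZMod 2) = 0 := rfl
  linear_combination h1 - (cf f 0 1 2 + cf f 0 2 1) * h2

/-! the polynomial `p6` -/
def LP : List (Fin 5 → ℕ) := [mv 4 4 4, mv 3 3 3, mv 2 2 2, mv 1 1 1, mv 4 0 4, mv 3 0 3, mv 2 0 2, mv 1 0 1]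

lemma p6_eq : p6 = (LP.map mon).sum := by
  have e1 : ![1,1,1,1,6] = mv 4 4 4 := (eqb_iff _ _).1 (by decide)
  have e2 : ![1,1,1,6,1] = mv 3 3 3 := (eqb_iff _ _).1 (by decide)
  have e3 : ![1,1,6,1,1] = mv 2 2 2 := (eqb_iff _ _).1 (by decide)
  have e4 : ![1,6,1,1,1] = mv 1 1 1 := (eqb_iff _ _).1 (by decide)
  have e5 : ![3,1,1,1,4] = mv 4 0 4 := (eqb_iff _ _).1 (by decide)
  have e6 : ![3,1,1,4,1] = mv 3 0 3 := (eqb_iff _ _).1 (by decide)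
  have e7 : ![3,1,4,1,1] = mv 2 0 2 := (eqb_iff _ _).1 (by decide)
  have e8 : ![3,4,1,1,1] = mv 1 0 1 := (eqb_iff _ _).1 (by decide)
  rw [p6, e1, e2, e3, e4, e5, e6, e7, e8]
  simp [LP, mon, add_assoc]

def cN (e i j : Fin 5) : ZMod 2 := if LP.countP (eqb (mv e i j)) % 2 = 1 then 1 else 0

lemma cf_p6 (e i j : Fin 5) : cf p6 e i j = cN e i j := by
  rw [cf, p6_eq, coeff_monL, cN]
  change ((LP.countP (eqb (mv e i j)) : ℕ) : ZMod 2) = _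
  split_ifs with h
  · rw [← ZMod.natCast_mod, h]; rfl
  · exact (ZMod.natCast_eq_zero_iff _ _).2 (by omega)

lemma sV_p6 (e i j : Fin 5) (h1 : e ≠ i) (h2 : e ≠ j) : sV p6 e i j = 0 := by
  simp only [sV, cf_p6]
  revert e i j
  decide +kernel

def dl (p j : Fin 5) : ZMod 2 := if p = j then 1 else 0

lemma dV_p6 (p q j : Fin 5) : dV p6 p j + dV p6 q j = dl p j + dl q j := by
  simp only [dV, cf_p6]
  revert p q j
  decide +kernel

lemma mv_le : ∀ e i j k : Fin 5, mv e i j k < 8 := by decide +kernel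
lemma mv_w : ∀ e i j : Fin 5, w5 (mv e i j) 0 = 4 ∧ w5 (mv e i j) 1 = 1 ∧ w5 (mv e i j) 2 = 1 := by
  decide +kernel

lemma mon_mem (e i j : Fin 5) : mon (mv e i j) ∈ PnLe 5 10 w411 := by
  refine Submodule.subset_span ⟨_, ?_, Or.inl ?_, rfl⟩
  · rw [mdeg5]; exact deg_mv e i j
  · funext k
    rw [wt_eq]
    change w5 (mv e i j) k = _
    match k with
    | 0 => exact (mv_w e i j).1
    | 1 => exact (mv_w e i j).2.1
    | 2 => exact (mv_w e i j).2.2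
    | k + 3 =>
      have h : ∀ l, mv e i j l / 2 ^ (k + 3) = 0 := fun l => by
        apply Nat.div_eq_of_lt
        have := mv_le e i j l
        have h2 : 2 ^ 3 ≤ 2 ^ (k + 3) := Nat.pow_le_pow_right (by norm_num) (by omega)
        omega
      simp [w5, h, w411]

lemma p6_mem : p6 ∈ PnLe 5 10 w411 := by
  rw [p6_eq]
  refine list_sum_mem fun x hx => ?_
  simp only [LP, List.map_cons, List.map_nil, List.mem_cons, List.not_mem_nil, or_false] at hx
  rcases hx with rfl | rfl | rfl | rfl | rfl | rfl | rfl | rfl <;> exact mon_mem _ _ _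

lemma rename_mem (σ : Equiv.Perm (Fin 5)) : rename σ p6 ∈ PnLe 5 10 w411 := by
  have h : ∀ e i j, rename σ (mon (mv e i j)) ∈ PnLe 5 10 w411 := by
    intro e i j
    have := mon_mem (σ e) (σ i) (σ j)
    rw [mon, mv_perm] at this
    rw [mon, rename_monomial]; exact this
  rw [p6_eq]
  simp only [LP, List.map_cons, List.map_nil, List.sum_cons, List.sum_nil, map_add, map_zero]
  repeat' apply Submodule.add_mem
  all_goals first | exact h _ _ _ | exact Submodule.zero_mem _

lemma p6_perm (σ : Equiv.Perm (Fin 5)) : rename σ p6 + p6 ∈ U := by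
  apply mem_U _ (Submodule.add_mem _ (rename_mem σ) p6_mem)
  · intro e i j h1 h2
    rw [sV_add, sV_p6 e i j h1 h2, add_zero]
    obtain ⟨e, rfl⟩ := σ.surjective e
    obtain ⟨i, rfl⟩ := σ.surjective i
    obtain ⟨j, rfl⟩ := σ.surjective j
    rw [sV_perm]
    exact sV_p6 e i j (fun h => h1 (by rw [h])) (fun h => h2 (by rw [h]))
  · intro p q j
    apply add_eq_zero2
    obtain ⟨p, rfl⟩ := σ.surjective p
    obtain ⟨q, rfl⟩ := σ.surjective q
    obtain ⟨j, rfl⟩ := σ.surjective j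
    rw [dV_add, dV_add, dV_perm, dV_perm]
    have a := dV_p6 p q j
    have b := dV_p6 (σ p) (σ q) (σ j)
    have c : dl (σ p) (σ j) + dl (σ q) (σ j) = dl p j + dl q j := by
      simp only [dl, σ.injective.eq_iff]
    have h2 : (2 : ZMod 2) = 0 := rfl
    linear_combination a + b + c + (dl p j + dl q j) * h2

lemma low_mem (v : Fin 5 → ℕ) (h1 : d5 v = 10) (h2 : low v = true) : mon v ∈ U :=
  Submodule.mem_sup_right (Submodule.subset_span
    ⟨ev v, by rw [mdeg5]; exact h1, (low_iff _).2 h2, rfl⟩)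

lemma r5_1 (a b c d : ℕ) : r5 (mon ![1, a, b, c, d]) = mon ![1, a, b, c, d] + mon ![0, a + 1, b, c, d] := by
  simp only [mon]
  rw [r5_mono]
  simp only [mono_X, Matrix.cons_val]; ring

lemma r5_3 (a b c d : ℕ) : r5 (mon ![3, a, b, c, d]) = mon ![3, a, b, c, d] + mon ![2, a + 1, b, c, d]
    + mon ![1, a + 2, b, c, d] + mon ![0, a + 3, b, c, d] := by
  have h2 : (2 : P 5) = 0 := CharTwo.two_eq_zero
  simp only [mon]
  rw [r5_mono]
  simp only [mono_X, Matrix.cons_val]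
  linear_combination (C 1 * (X 0 ^ 2 * X 1 + X 0 * X 1 ^ 2) * X 1 ^ a * X 2 ^ b * X 3 ^ c * X 4 ^ d) * h2

lemma p6_rho5 : r5 p6 + p6 ∈ U := by
  by_contra hn
  obtain ⟨ψ, h1, hψ⟩ := Submodule.exists_le_ker_of_notMem hn
  apply h1
  have L : ∀ v, d5 v = 10 → low v = true → ψ (mon v) = 0 := fun v a b => hψ (low_mem v a b)
  change ψ (r5 (mon ![1,1,1,1,6] + mon ![1,1,1,6,1] + mon ![1,1,6,1,1] + mon ![1,6,1,1,1]
    + mon ![3,1,1,1,4] + mon ![3,1,1,4,1] + mon ![3,1,4,1,1] + mon ![3,4,1,1,1])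
    + (mon ![1,1,1,1,6] + mon ![1,1,1,6,1] + mon ![1,1,6,1,1] + mon ![1,6,1,1,1]
    + mon ![3,1,1,1,4] + mon ![3,1,1,4,1] + mon ![3,1,4,1,1] + mon ![3,4,1,1,1])) = 0
  have R : ψ _ = 0 := hψ (rel2 1)
  have R2 : ψ _ = 0 := hψ (rel1 2 2 1 (by decide))
  have R3 : ψ _ = 0 := hψ (rel1 3 3 1 (by decide))
  have R4 : ψ _ = 0 := hψ (rel1 4 4 1 (by decide))
  have e1 : mv 0 0 1 = ![2,5,1,1,1] := (eqb_iff _ _).1 (by decide)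
  have e2 : mv 1 1 1 = ![1,6,1,1,1] := (eqb_iff _ _).1 (by decide)
  have e3 : mv 2 1 2 = ![1,3,4,1,1] := (eqb_iff _ _).1 (by decide)
  have e4 : mv 3 1 3 = ![1,3,1,4,1] := (eqb_iff _ _).1 (by decide)
  have e5 : mv 4 1 4 = ![1,3,1,1,4] := (eqb_iff _ _).1 (by decide)
  rw [e1, e2] at R
  rw [e3] at R2
  rw [e4] at R3
  rw [e5] at R4
  simp only [map_add] at R R2 R3 R4 ⊢
  simp only [r5_1, r5_3, map_add, Nat.reduceAdd]
  rw [L ![0,2,1,1,6] (by decide) (by decide), L ![0,2,1,6,1] (by decide) (by decide),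
    L ![0,2,6,1,1] (by decide) (by decide), 
    L ![2,2,1,1,4] (by decide) (by decide), L ![2,2,1,4,1] (by decide) (by decide),
    L ![2,2,4,1,1] (by decide) (by decide),
    L ![0,4,1,1,4] (by decide) (by decide), L ![0,4,1,4,1] (by decide) (by decide),
    L ![0,4,4,1,1] (by decide) (by decide)]
  generalize ψ (mon ![1,1,1,1,6]) = a1 at *
  generalize ψ (mon ![1,1,1,6,1]) = a2 at *
  generalize ψ (mon ![1,1,6,1,1]) = a3 at *
  generalize ψ (mon ![1,6,1,1,1]) = a4 at *
  generalize ψ (mon ![3,1,1,1,4]) = a5 at *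
  generalize ψ (mon ![3,1,1,4,1]) = a6 at *
  generalize ψ (mon ![3,1,4,1,1]) = a7 at *
  generalize ψ (mon ![3,4,1,1,1]) = a8 at *
  generalize ψ (mon (mv 2 2 1)) = b2 at *
  generalize ψ (mon (mv 3 3 1)) = b3 at *
  generalize ψ (mon (mv 4 4 1)) = b4 at *
  generalize ψ (mon ![0,7,1,1,1]) = b1 at *
  have h2 : (2 : ZMod 2) = 0 := rfl
  linear_combination R + R2 + R3 + R4 + (a1+a2+a3+a4+a5+a6+a7+a8+b1 - b2 - b3 - b4) * h2

lemma z2d {x : ZMod 2} : x = 0 ∨ x = 1 := by revert x; decide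

lemma main2 (f : P 5) (hf : f ∈ PnLe 5 10 w411)
    (hσ : ∀ i : Fin 4, rename (Equiv.swap i.castSucc i.succ) f + f ∈ U)
    (h5 : r5 f + f ∈ U) : f ∈ U ∨ f + p6 ∈ U := by
  have hz : ZZ f := nv_zero f hf
  have inv : ∀ σ, InvP f σ := inv_all f fun i => inv_of f hz _ (hσ i)
  have hdc := d_const f inv
  have h2 : (2 : ZMod 2) = 0 := rfl
  -- the value E
  obtain ⟨E, hE⟩ : ∃ E, E = dV f 0 0 + dV f 1 0 := ⟨_, rfl⟩
  have hd : ∀ j q, j ≠ q → dV f j j + dV f q j = E := by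
    intro j q hjq
    obtain ⟨σ, rfl, rfl⟩ := tr2 j q hjq
    rw [(inv σ).2 0 1 0, hE]
  have hDl : ∀ p q j, dV f p j + dV f q j = E * (dl p j + dl q j) := by
    intro p q j
    unfold dl
    by_cases hp : p = j <;> by_cases hq : q = j
    · subst hp; subst hq; simp only [if_true]; linear_combination (dV f q q - E) * h2
    · subst hp; simp only [if_true, if_neg hq, add_zero, mul_one]
      exact hd p q (fun h => hq h.symm)
    · subst hq; simp only [if_true, if_neg hp, zero_add, mul_one]
      rw [add_comm]; exact hd q p (fun h => hp h.symm)
    · simp only [if_neg hp, if_neg hq, add_zero, mul_zero]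
      rw [hdc p q j hp hq]; linear_combination dV f q j * h2
  have hB : sV f 1 0 0 = 0 := by
    have := rho_B f h5
    rw [hDl 0 1 0, hDl 0 1 1] at this
    simp only [dl, if_true, if_false, zero_ne_one, one_ne_zero] at this
    linear_combination this - E * h2
  have hA : sV f 1 0 2 = 0 := by
    have := rho_A f hz h5
    rw [hdc 0 1 2 (by decide) (by decide)] at this
    linear_combination this - dV f 1 2 * h2
  have hS : ∀ e i j, e ≠ i → e ≠ j → sV f e i j = 0 := by
    intro e i j h1 h2
    by_cases hij : i = j
    · subst hij
      obtain ⟨σ, rfl, rfl⟩ := tr2 i e h1.symm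
      rw [(inv σ).1 1 0 0 (by decide) (by decide)]; exact hB
    · obtain ⟨σ, rfl, rfl, rfl⟩ := tr3 i e j h1.symm hij h2
      rw [(inv σ).1 1 0 2 (by decide) (by decide)]; exact hA
  rcases z2d (x := E) with h0 | h0
  · left
    apply mem_U f hf hS
    intro p q j
    apply add_eq_zero2
    rw [hDl, h0, zero_mul]
  · right
    apply mem_U _ (Submodule.add_mem _ hf p6_mem)
    · intro e i j h1 h2
      rw [sV_add, hS e i j h1 h2, sV_p6 e i j h1 h2, add_zero]
    · intro p q j
      apply add_eq_zero2
      rw [dV_add, dV_add]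
      have a := hDl p q j
      have b := dV_p6 p q j
      rw [h0] at a
      linear_combination a + b + (dl p j + dl q j) * h2

lemma p6_not : p6 ∉ U := by
  intro h
  have := D_of_U _ h (nv_zero _ p6_mem) 0 1 0
  rw [dV_p6] at this
  exact absurd this (by decide)

/-- with `ω = (4,1,1)`: (i) `p_6 ∉ A^+P_5 + P_5^−(ω)` while
`ρ_i(p_6) + p_6 ∈ A^+P_5 + P_5^−(ω)` for all `1 ≤ i ≤ 5`; (ii) every `f ∈ P_5(ω)` with
`ρ_i(f) + f ∈ A^+P_5 + P_5^−(ω)` for all `1 ≤ i ≤ 5` satisfies `f ∈ A^+P_5 + P_5^−(ω)`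
or `f + p_6 ∈ A^+P_5 + P_5^−(ω)`. -/
theorem statement17 :
    (p6 ∉ hitS 5 ⊔ PnLt 5 10 w411 ∧
      ∀ i : ℕ, 1 ≤ i → i ≤ 5 → rho5 i p6 + p6 ∈ hitS 5 ⊔ PnLt 5 10 w411) ∧
    (∀ f ∈ PnLe 5 10 w411,
      (∀ i : ℕ, 1 ≤ i → i ≤ 5 → rho5 i f + f ∈ hitS 5 ⊔ PnLt 5 10 w411) →
        f ∈ hitS 5 ⊔ PnLt 5 10 w411 ∨ f + p6 ∈ hitS 5 ⊔ PnLt 5 10 w411) := by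
  refine ⟨⟨p6_not, ?_⟩, ?_⟩
  · intro i h1 h2
    obtain rfl | rfl | rfl | rfl | rfl : i = 1 ∨ i = 2 ∨ i = 3 ∨ i = 4 ∨ i = 5 := by omega
    · exact p6_perm _
    · exact p6_perm _
    · exact p6_perm _
    · exact p6_perm _
    · exact p6_rho5
  · intro f hf h
    apply main2 f hf
    · intro i
      fin_cases i
      · exact h 1 (by norm_num) (by norm_num)
      · exact h 2 (by norm_num) (by norm_num)
      · exact h 3 (by norm_num) (by norm_num)
      · exact h 4 (by norm_num) (by norm_num)
    · exact h 5 (by norm_num) (by norm_num)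
end
end

section
/- Let ω = (4,3) (so ω_1 = 4, ω_2 = 3, ω_i = 0 for i > 2; deg ω = 10). Every f ∈ P_5(ω) with ρ_i(f) + f ∈ A^+P_5 + P_5^−(ω) for all 1 ≤ i ≤ 5 satisfies f ∈ A^+P_5 + P_5^−(ω). (Equivalently, the GL_5-invariant subspace of QP_5(4,3) is zero.) -/
open MvPolynomial

noncomputable section

/-- The weight vector `(4,3)` (zero-based indexing). -/
def w43 : ℕ → ℕ := fun i => if i = 0 then 4 else if i = 1 then 3 else 0

lemma ev_apply5 {n : ℕ} (v : Fin n → ℕ) (i : Fin n) : ev v i = v i := rfl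

lemma ev_coe5 {n : ℕ} (a : Fin n →₀ ℕ) : ev (⇑a) = a := by ext i; rfl

lemma ev_inj5 {n : ℕ} {v w : Fin n → ℕ} (h : ev v = ev w) : v = w := by
  funext i; rw [← ev_apply5 v i, h]; rfl

lemma prodX5 {n : ℕ} (v : Fin n → ℕ) :
    (∏ i, (X i : P n) ^ v i) = monomial (ev v) 1 := by
  rw [MvPolynomial.monomial_eq, Finsupp.prod_fintype _ _ (by simp)]
  simp [ev_apply5]

/-- coefficients of a product of one-variable polynomials -/
lemma coeff_prod5 {n : ℕ} (p : Fin n → Polynomial (ZMod 2)) (v : Fin n → ℕ) :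
    coeff (ev v) (∏ i, Polynomial.aeval (X i : P n) (p i)) = ∏ i, (p i).coeff (v i) := by
  classical
  obtain ⟨N, hN⟩ : ∃ N : ℕ, (∀ i, (p i).natDegree < N) ∧ ∀ i, v i < N := by
    refine ⟨(∑ i, (p i).natDegree) + (∑ i, v i) + 1, fun i => ?_, fun i => ?_⟩
    · have := Finset.single_le_sum (f := fun i => (p i).natDegree) (fun _ _ => Nat.zero_le _)
        (Finset.mem_univ i)
      omega
    · have := Finset.single_le_sum (f := v) (fun _ _ => Nat.zero_le _) (Finset.mem_univ i)
      omega
  have h1 : ∀ i, Polynomial.aeval (X i : P n) (p i)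
      = ∑ k ∈ Finset.range N, (p i).coeff k • (X i : P n) ^ k := fun i =>
    Polynomial.aeval_eq_sum_range' (hN.1 i) _
  simp_rw [h1]
  rw [Finset.prod_univ_sum, coeff_sum]
  rw [Finset.sum_eq_single v]
  · simp_rw [Finset.prod_smul, prodX5, coeff_smul, coeff_monomial]
    simp
  · intro w _ hw
    simp_rw [Finset.prod_smul, prodX5, coeff_smul, coeff_monomial]
    rw [if_neg (fun h => hw (ev_inj5 h))]; simp
  · intro h
    exact absurd (Fintype.mem_piFinset.2 fun i => Finset.mem_range.2 (hN.2 i)) h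

def c2 (m k : ℕ) : ZMod 2 := ((Polynomial.X + Polynomial.X ^ 2 : Polynomial (ZMod 2)) ^ m).coeff k

lemma c2_eq (m k : ℕ) : c2 m k = if m ≤ k then (m.choose (k - m) : ZMod 2) else 0 := by
  have : (Polynomial.X + Polynomial.X ^ 2 : Polynomial (ZMod 2)) ^ m
      = Polynomial.X ^ m * (1 + Polynomial.X) ^ m := by rw [← mul_pow]; ring
  rw [c2, this, Polynomial.coeff_X_pow_mul', Polynomial.coeff_one_add_X_pow]

lemma c2_zero (m : ℕ) : c2 m 0 = if m = 0 then 1 else 0 := by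
  rw [c2_eq]; rcases m with _ | m <;> simp

lemma c2_one (m : ℕ) : c2 m 1 = if m = 1 then 1 else 0 := by
  rw [c2_eq]; rcases m with _ | _ | m <;> simp

lemma c2_two (m : ℕ) : c2 m 2 = if m = 1 ∨ m = 2 then 1 else 0 := by
  rw [c2_eq]; rcases m with _ | _ | _ | m <;> simp

lemma c2_three (m : ℕ) : c2 m 3 = if m = 3 then 1 else 0 := by
  rw [c2_eq]
  rcases m with _ | _ | _ | _ | m <;> simp
  decide

lemma coeff_sqTot_s18 (m : Fin 5 →₀ ℕ) (v : Fin 5 → ℕ) :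
    coeff (ev v) (sqTot 5 (monomial m 1)) = ∏ i, c2 (m i) (v i) := by
  unfold c2
  rw [← coeff_prod5]
  congr 1
  rw [sqTot, bind₁_monomial, map_one, one_mul, Finset.prod_subset (Finset.subset_univ _)]
  · simp
  · intro i _ hi
    simp [Finsupp.notMem_support_iff.1 hi]

lemma mdeg_degree (a : Fin 5 →₀ ℕ) : a.degree = mdeg a := by
  rw [Finsupp.degree_eq_sum, mdeg]

lemma sqTot_kill (φ : P 5 →ₗ[ZMod 2] ZMod 2)
    (hφ : ∀ m : Fin 5 →₀ ℕ, mdeg m < 10 → φ (sqTot 5 (monomial m 1)) = 0) (d : ℕ) (hd : d < 10)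
    (h : P 5) : φ (sqTot 5 (homogeneousComponent d h)) = 0 := by
  rw [homogeneousComponent_apply, map_sum, map_sum]
  refine Finset.sum_eq_zero fun m hm => ?_
  have hm' := (Finset.mem_filter.1 hm).2
  have : (monomial m (coeff m h) : P 5) = coeff m h • monomial m 1 := by
    rw [smul_monomial]; simp
  rw [this, map_smul, map_smul, hφ m, smul_zero]
  rw [← mdeg_degree, hm']; exact hd

lemma coeff_SqK (j : ℕ) (h : P 5) (a : Fin 5 →₀ ℕ) (ha : mdeg a = 10) :
    coeff a (SqK 5 j h) = if j ≤ 10 then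
      coeff a (sqTot 5 (homogeneousComponent (10 - j) h)) else 0 := by
  rw [SqK, coeff_sum]
  simp_rw [coeff_homogeneousComponent, mdeg_degree, ha]
  split_ifs with hj
  · by_cases hd : 10 - j < h.totalDegree + 1
    · rw [Finset.sum_eq_single (10 - j)]
      · rw [if_pos (by omega)]
      · intro d _ hd; rw [if_neg (by omega)]
      · intro h; exact absurd (Finset.mem_range.2 hd) h
    · rw [homogeneousComponent_eq_zero (10 - j) h (by omega)]
      simp only [map_zero, coeff_zero]
      refine Finset.sum_eq_zero fun d hd' => ?_
      rw [Finset.mem_range] at hd'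
      rw [if_neg (by omega)]
  · exact Finset.sum_eq_zero fun d hd => if_neg (by omega)

def M5 : Submodule (ZMod 2) (P 5) := hitS 5 ⊔ PnLt 5 10 w43

lemma not_lexLt (v : Fin 5 → ℕ) (h0 : ∑ i, v i % 2 = 4) (hs : ∑ i, v i = 10) (h3 : ∀ i, v i ≤ 3) :
    ¬ lexLt (wt (ev v)) w43 := by
  have a0 : wt (ev v) 0 = 4 := by simpa [wt, ev_apply5] using h0
  have a1 : wt (ev v) 1 = 3 := by
    have hh : ∀ i, v i / 2 ^ 1 % 2 = v i / 2 := fun i => by have := h3 i; omega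
    simp only [wt, ev_apply5, hh, Fin.sum_univ_five] at h0 hs ⊢
    omega
  rintro ⟨i, _, hi⟩
  rcases i with _ | _ | i
  · simp [a0, w43] at hi
  · simp [a1, w43] at hi
  · simp [w43] at hi

lemma kill_two (v w : Fin 5 → ℕ)
    (hv0 : ∑ i, v i % 2 = 4) (hvs : ∑ i, v i = 10) (hv3 : ∀ i, v i ≤ 3)
    (hw0 : ∑ i, w i % 2 = 4) (hws : ∑ i, w i = 10) (hw3 : ∀ i, w i ≤ 3) (r : ZMod 2)
    (hk : ∀ m : Fin 5 →₀ ℕ, mdeg m < 10 → ∏ i, c2 (m i) (v i) + r * ∏ i, c2 (m i) (w i) = 0)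
    (g : P 5) (hg : g ∈ M5) : coeff (ev v) g + r * coeff (ev w) g = 0 := by
  let φ : P 5 →ₗ[ZMod 2] ZMod 2 := lcoeff (ZMod 2) (ev v) + r • lcoeff (ZMod 2) (ev w)
  have hφ : ∀ g, φ g = coeff (ev v) g + r * coeff (ev w) g := fun g => by
    simp [φ]
  have key : M5 ≤ LinearMap.ker φ := by
    refine sup_le (Submodule.span_le.2 ?_) (Submodule.span_le.2 ?_)
    · rintro _ ⟨j, hj, h, rfl⟩
      rw [SetLike.mem_coe, LinearMap.mem_ker, hφ, coeff_SqK _ _ _ (by simpa [mdeg, ev_apply5]),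
        coeff_SqK _ _ _ (by simpa [mdeg, ev_apply5])]
      split_ifs with hj'
      · rw [← hφ]
        refine sqTot_kill φ (fun m hm => ?_) _ (by omega) h
        rw [hφ, coeff_sqTot_s18, coeff_sqTot_s18, hk m hm]
      · simp
    · rintro _ ⟨a, ha, hl, rfl⟩
      rw [SetLike.mem_coe, LinearMap.mem_ker, hφ, coeff_monomial, coeff_monomial,
        if_neg, if_neg]
      · simp
      · rintro rfl; exact not_lexLt w hw0 hws hw3 hl
      · rintro rfl; exact not_lexLt v hv0 hvs hv3 hl
  rw [← hφ]; exact key hg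

structure Aty (v : Fin 5 → ℕ) : Prop where
  h0 : ∑ i, v i % 2 = 4
  hs : ∑ i, v i = 10
  hv : ∀ i, v i = 0 ∨ v i = 1 ∨ v i = 3

structure Bty (e : Fin 5 → ℕ) : Prop where
  hs : ∑ i, e i = 9
  he : ∀ i, e i = 1 ∨ e i = 3

lemma c2_ne (m k : ℕ) (hk : k = 0 ∨ k = 1 ∨ k = 3) : c2 m k = if m = k then 1 else 0 := by
  rcases hk with rfl | rfl | rfl
  exacts [c2_zero m, c2_one m, c2_three m]

lemma prodA (m v : Fin 5 → ℕ) (hv : ∀ i, v i = 0 ∨ v i = 1 ∨ v i = 3) :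
    ∏ i, c2 (m i) (v i) = if m = v then 1 else 0 := by
  simp_rw [fun i => c2_ne (m i) (v i) (hv i), Finset.prod_ite_zero, funext_iff]
  simp

lemma killA (v : Fin 5 → ℕ) (h : Aty v) (g : P 5) (hg : g ∈ M5) : coeff (ev v) g = 0 := by
  have h3 : ∀ i, v i ≤ 3 := fun i => by rcases h.hv i with h | h | h <;> omega
  have := kill_two v v h.h0 h.hs h3 h.h0 h.hs h3 0 (fun m hm => ?_) g hg
  · simpa using this
  · rw [prodA _ _ h.hv, if_neg]
    · simp
    · intro hmv
      rw [mdeg, hmv, h.hs] at hm; omega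

lemma prodB (m e : Fin 5 → ℕ) (he : Bty e) (p : Fin 5) (hp : e p = 1) :
    ∏ i, c2 (m i) (Function.update e p 2 i)
      = if m = e ∨ m = Function.update e p 2 then 1 else 0 := by
  have : ∀ i, c2 (m i) (Function.update e p 2 i)
      = if (m i = e i ∨ m i = Function.update e p 2 i) then 1 else 0 := by
    intro i
    by_cases hi : i = p
    · subst hi; simp [c2_two, hp]
    · simp only [Function.update_of_ne hi, or_self]
      exact c2_ne _ _ (Or.inr (he.he i))
  simp_rw [this, Finset.prod_ite_zero]
  simp only [Finset.mem_univ, true_implies, Finset.prod_const_one]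
  congr 1
  rw [eq_iff_iff]
  constructor
  · intro h
    rcases h p with h' | h'
    · left; funext i
      by_cases hi : i = p
      · rw [hi, h']
      · simpa [Function.update_of_ne hi] using h i
    · right; funext i
      by_cases hi : i = p
      · rw [hi, h']
      · simpa [Function.update_of_ne hi] using h i
  · rintro (rfl | h) i
    · left; rfl
    · right; rw [h]

lemma updB (e : Fin 5 → ℕ) (he : Bty e) (p : Fin 5) (hp : e p = 1) :
    ∑ i, Function.update e p 2 i % 2 = 4 ∧ ∑ i, Function.update e p 2 i = 10 ∧
      ∀ i, Function.update e p 2 i ≤ 3 := by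
  have hs := he.hs
  have h0 := he.he 0; have h1 := he.he 1; have h2 := he.he 2; have h3 := he.he 3
  have h4 := he.he 4
  refine ⟨?_, ?_, ?_⟩
  · fin_cases p <;> simp [Fin.sum_univ_five, Function.update_apply] at * <;> omega
  · fin_cases p <;> simp [Fin.sum_univ_five, Function.update_apply] at * <;> omega
  · intro i
    rw [Function.update_apply]
    split_ifs
    · omega
    · rcases he.he i with h | h <;> omega

lemma killB (e : Fin 5 → ℕ) (he : Bty e) (p q : Fin 5) (hp : e p = 1) (hq : e q = 1)
    (g : P 5) (hg : g ∈ M5) :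
    coeff (ev (Function.update e p 2)) g + coeff (ev (Function.update e q 2)) g = 0 := by
  obtain ⟨a, b, c⟩ := updB e he p hp
  obtain ⟨a', b', c'⟩ := updB e he q hq
  have := kill_two _ _ a b c a' b' c' 1 (fun m hm => ?_) g hg
  · simpa using this
  · rw [prodB _ e he p hp, prodB _ e he q hq]
    have n1 : ¬ (⇑m = Function.update e p 2) := fun h => by rw [mdeg, h] at hm; omega
    have n2 : ¬ (⇑m = Function.update e q 2) := fun h => by rw [mdeg, h] at hm; omega
    simp only [n1, n2, or_false, one_mul]
    exact CharTwo.add_self_eq_zero _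

lemma coeff_ren (σ : Equiv.Perm (Fin 5)) (v : Fin 5 → ℕ) (f : P 5) :
    coeff (ev v) (rename σ f) = coeff (ev (v ∘ σ)) f := by
  have : ev v = Finsupp.mapDomain σ (ev (v ∘ σ)) := by
    ext i
    obtain ⟨j, rfl⟩ := σ.surjective i
    rw [Finsupp.mapDomain_apply σ.injective]; rfl
  rw [this, coeff_rename_mapDomain _ σ.injective]

lemma Aty.comp {v : Fin 5 → ℕ} (h : Aty v) (σ : Equiv.Perm (Fin 5)) : Aty (v ∘ σ) :=
  ⟨by rw [← h.h0]; exact Equiv.sum_comp σ (fun i => v i % 2),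
   by rw [← h.hs]; exact Equiv.sum_comp σ v, fun i => h.hv (σ i)⟩

lemma Bty.comp {v : Fin 5 → ℕ} (h : Bty v) (σ : Equiv.Perm (Fin 5)) : Bty (v ∘ σ) :=
  ⟨by rw [← h.hs]; exact Equiv.sum_comp σ v, fun i => h.he (σ i)⟩

lemma upd_comp (e : Fin 5 → ℕ) (p : Fin 5) (σ : Equiv.Perm (Fin 5)) :
    Function.update e p 2 ∘ σ = Function.update (e ∘ σ) (σ.symm p) 2 := by
  funext i
  simp only [Function.comp, Function.update_apply, Equiv.eq_symm_apply]

def InvS (f : P 5) (σ : Equiv.Perm (Fin 5)) : Prop :=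
  (∀ v, Aty v → coeff (ev (v ∘ σ)) f = coeff (ev v) f) ∧
  ∀ e p q, Bty e → e p = 1 → e q = 1 →
    coeff (ev (Function.update e p 2 ∘ σ)) f + coeff (ev (Function.update e q 2 ∘ σ)) f
    = coeff (ev (Function.update e p 2)) f + coeff (ev (Function.update e q 2)) f

lemma InvS_of (f : P 5) (σ : Equiv.Perm (Fin 5)) (h : rename σ f + f ∈ M5) : InvS f σ := by
  constructor
  · intro v hv
    have := killA v hv _ h
    rw [coeff_add, coeff_ren] at this
    exact CharTwo.add_eq_zero.1 this
  · intro e p q he hp hq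
    have := killB e he p q hp hq _ h
    rw [coeff_add, coeff_ren, coeff_add, coeff_ren] at this
    rw [← CharTwo.add_eq_zero, ← this]; ring

lemma InvS_mul (f : P 5) (σ τ : Equiv.Perm (Fin 5)) (h1 : InvS f σ) (h2 : InvS f τ) :
    InvS f (σ * τ) := by
  constructor
  · intro v hv
    rw [← h1.1 v hv, ← h2.1 _ (hv.comp σ)]; rfl
  · intro e p q he hp hq
    rw [← h1.2 e p q he hp hq]
    have := h2.2 (e ∘ σ) (σ.symm p) (σ.symm q) (he.comp σ) (by simpa) (by simpa)
    rw [← upd_comp, ← upd_comp] at this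
    rw [← this]; rfl

lemma InvS_all (f : P 5) (h : ∀ i : Fin 4, InvS f (Equiv.swap i.castSucc i.succ))
    (σ : Equiv.Perm (Fin 5)) : InvS f σ := by
  have hσ : σ ∈ Submonoid.closure (Set.range fun i : Fin 4 => Equiv.swap i.castSucc i.succ) := by
    rw [Equiv.Perm.mclosure_swap_castSucc_succ]; trivial
  induction hσ using Submonoid.closure_induction with
  | mem x hx => obtain ⟨i, rfl⟩ := hx; exact h i
  | one => exact ⟨fun _ _ => rfl, fun _ _ _ _ _ _ => rfl⟩
  | mul x y _ _ hx hy => exact InvS_mul f x y hx hy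

lemma aeval_mon (t : Fin 5 → P 5) (m : Fin 5 →₀ ℕ) (c : ZMod 2) :
    aeval (R := ZMod 2) t (monomial m c) = c • ∏ i, t i ^ m i := by
  rw [aeval_monomial, Finsupp.prod_fintype _ _ (by simp), Algebra.smul_def]

/-- setting `x_1 = 0` does not change coefficients of monomials free of `x_1` -/
lemma coeff_eps (v : Fin 5 → ℕ) (h0 : v 0 = 0) (g : P 5) :
    coeff (ev v) (aeval (R := ZMod 2) (fun j : Fin 5 => if j = 0 then (0 : P 5) else X j) g)
      = coeff (ev v) g := by
  induction g using MvPolynomial.induction_on' with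
  | monomial m c =>
    rw [aeval_mon]
    by_cases hm : m 0 = 0
    · have : (∏ i : Fin 5, (if i = 0 then (0 : P 5) else X i) ^ m i) = monomial m 1 := by
        rw [← ev_coe5 m, ← prodX5]
        refine Finset.prod_congr rfl fun i _ => ?_
        by_cases hi : i = 0
        · subst hi; simp [ev_apply5, hm]
        · simp [hi, ev_apply5]
      rw [this, smul_monomial]; simp
    · rw [Finset.prod_eq_zero (Finset.mem_univ 0) (by simp [hm]), smul_zero, coeff_monomial,
        if_neg, coeff_zero]
      rintro rfl; exact hm h0
  | add p q hp hq => rw [map_add, coeff_add, coeff_add, hp, hq]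

lemma coeff_rho5 (f : P 5) :
    coeff (ev ![0, 1, 3, 3, 3]) (rho5 5 f)
      = coeff (ev ![0, 1, 3, 3, 3]) f + coeff (ev ![1, 0, 3, 3, 3]) f := by
  rw [← coeff_eps _ rfl]
  induction f using MvPolynomial.induction_on' with
  | monomial m c =>
    have : aeval (R := ZMod 2) (fun j : Fin 5 => if j = 0 then (0 : P 5) else X j)
        (rho5 5 (monomial m c)) = monomial (ev ![0, m 0 + m 1, m 2, m 3, m 4]) c := by
      have e : (monomial (ev ![0, m 0 + m 1, m 2, m 3, m 4]) c : P 5)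
          = c • monomial (ev ![0, m 0 + m 1, m 2, m 3, m 4]) 1 := by
        rw [smul_monomial]; simp
      rw [e, ← prodX5, rho5]
      simp only [OfNat.ofNat_ne_one, if_true, aeval_mon]
      norm_num
      simp [Fin.prod_univ_five, pow_add]
    rw [this, coeff_monomial, coeff_monomial, coeff_monomial]
    have h1 : ∀ v w : Fin 5 → ℕ, ev v = ev w ↔ v = w := fun v w => ⟨ev_inj5, fun h => h ▸ rfl⟩
    have h2 : ∀ w : Fin 5 → ℕ, m = ev w ↔ ⇑m = w := fun w => by
      rw [← h1, ev_coe5]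
    simp only [h1, h2, funext_iff, Fin.forall_fin_succ, Fin.forall_fin_zero_pi]
    simp
    rcases hm0 : m 0 with _ | _ | k <;> rcases hm1 : m 1 with _ | _ | l <;> simp
    all_goals omega
  | add p q hp hq =>
    have : rho5 5 (p + q) = rho5 5 p + rho5 5 q := by simp [rho5]
    rw [this, map_add, coeff_add, hp, hq, coeff_add, coeff_add]; ring

lemma classify_s18 (v : Fin 5 → ℕ) (hs : ∑ i, v i = 10) :
    lexLt (wt (ev v)) w43 ∨ (∑ i, v i % 2 = 4 ∧ ∀ i, v i ≤ 3) := by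
  have e0 : wt (ev v) 0 = ∑ i, v i % 2 := by simp [wt, ev_apply5]
  have e1 : wt (ev v) 1 = ∑ i, v i / 2 % 2 := by simp [wt, ev_apply5]
  by_cases h0 : ∑ i, v i % 2 = 4
  · by_cases h1 : ∑ i, v i / 2 % 2 < 3
    · left
      refine ⟨1, fun j hj => ?_, by simpa [e1, w43]⟩
      obtain rfl : j = 0 := by omega
      simp [e0, h0, w43]
    · right
      refine ⟨h0, ?_⟩
      simp only [Fin.sum_univ_five] at *
      have h5 : v 0 / 2 + v 1 / 2 + v 2 / 2 + v 3 / 2 + v 4 / 2 = 3 := by omega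
      have h6 : v 0 / 2 ≤ 1 ∧ v 1 / 2 ≤ 1 ∧ v 2 / 2 ≤ 1 ∧ v 3 / 2 ≤ 1 ∧ v 4 / 2 ≤ 1 := by
        clear hs h0 e0 e1
        generalize v 0 / 2 = a at *
        generalize v 1 / 2 = b at *
        generalize v 2 / 2 = c at *
        generalize v 3 / 2 = d at *
        generalize v 4 / 2 = e at *
        omega
      intro i
      fin_cases i <;> simp <;> omega
  · left
    refine ⟨0, fun j hj => by omega, ?_⟩
    simp only [e0, w43, if_true]
    simp only [Fin.sum_univ_five] at *
    omega

lemma typeAB (v : Fin 5 → ℕ) (hs : ∑ i, v i = 10) (h0 : ∑ i, v i % 2 = 4) (h3 : ∀ i, v i ≤ 3) :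
    Aty v ∨ ∃ e p, Bty e ∧ e p = 1 ∧ v = Function.update e p 2 := by
  by_cases h : ∃ p, v p = 2
  · right
    obtain ⟨p, hp⟩ := h
    refine ⟨Function.update v p 1, p, ⟨?_, ?_⟩, by simp, by simp [← hp]⟩
    · simp only [Fin.sum_univ_five] at *
      fin_cases p <;> simp [Function.update_apply] at * <;> omega
    · intro i
      by_cases hi : i = p
      · simp [hi]
      · rw [Function.update_of_ne hi]
        have a0 := h3 i
        simp only [Fin.sum_univ_five] at *
        fin_cases p <;> fin_cases i <;> simp at * <;> omega
  · left
    push Not at h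
    exact ⟨h0, hs, fun i => by have := h3 i; have := h i; omega⟩

lemma Aty_form (v : Fin 5 → ℕ) (h : Aty v) :
    ∃ σ : Equiv.Perm (Fin 5), v = ![1, 0, 3, 3, 3] ∘ σ := by
  obtain ⟨h0, hs, hv⟩ := h
  have a0 := hv 0; have a1 := hv 1; have a2 := hv 2; have a3 := hv 3; have a4 := hv 4
  simp only [Fin.sum_univ_five] at h0 hs
  obtain ⟨i, hi⟩ : ∃ i, v i = 1 := by
    by_contra hc
    push Not at hc
    have := hc 0; have := hc 1; have := hc 2; have := hc 3; have := hc 4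
    omega
  obtain ⟨j, hj⟩ : ∃ j, v j = 0 := by
    by_contra hc
    push Not at hc
    have := hc 0; have := hc 1; have := hc 2; have := hc 3; have := hc 4
    omega
  have hij : i ≠ j := by rintro rfl; omega
  have hk : ∀ k, k ≠ i → k ≠ j → v k = 3 := by
    intro k hki hkj
    have t1 := Finset.sum_add_sum_compl ({i, j, k} : Finset (Fin 5)) v
    have hc : ({i, j, k} : Finset (Fin 5)).card = 3 :=
      Finset.card_eq_three.2 ⟨i, j, k, hij, hki.symm, hkj.symm, rfl⟩
    have t2 : ∑ x ∈ ({i, j, k} : Finset (Fin 5))ᶜ, v x ≤ 6 := by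
      refine (Finset.sum_le_card_nsmul _ _ 3 fun x _ => ?_).trans ?_
      · rcases hv x with h | h | h <;> omega
      · rw [Finset.card_compl, hc]; simp
    rw [Finset.sum_insert (by simp [hij, hki.symm]), Finset.sum_insert (by simp [hkj.symm]),
      Finset.sum_singleton, hi, hj, Fin.sum_univ_five, hs] at t1
    rcases hv k with h | h | h <;> omega
  have hσ : ∀ i j : Fin 5, i ≠ j →
      (Equiv.swap (Equiv.swap i 0 j) 1 * Equiv.swap i 0) i = 0 ∧
      (Equiv.swap (Equiv.swap i 0 j) 1 * Equiv.swap i 0) j = 1 := by decide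
  obtain ⟨s1, s2⟩ := hσ i j hij
  refine ⟨Equiv.swap (Equiv.swap i 0 j) 1 * Equiv.swap i 0, ?_⟩
  generalize Equiv.swap (Equiv.swap i 0 j) 1 * Equiv.swap i 0 = σ at *
  have h3 : ∀ x : Fin 5, x ≠ 0 → x ≠ 1 → (![1, 0, 3, 3, 3] : Fin 5 → ℕ) x = 3 := by decide
  funext k
  rw [Function.comp]
  by_cases hki : k = i
  · rw [hki, s1, hi]; rfl
  by_cases hkj : k = j
  · rw [hkj, s2, hj]; rfl
  rw [hk k hki hkj, h3]
  · rw [← s1]; exact fun h => hki (σ.injective h)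
  · rw [← s2]; exact fun h => hkj (σ.injective h)

lemma R_eq (e : Fin 5 → ℕ) (he : Bty e) :
    SqK 5 1 (monomial (ev e) 1) = homogeneousComponent 10 (sqTot 5 (monomial (ev e) 1)) := by
  have hd : (ev e).degree = 9 := by rw [mdeg_degree]; exact he.hs
  have hom : (monomial (ev e) 1 : P 5) ∈ homogeneousSubmodule (Fin 5) (ZMod 2) 9 :=
    isHomogeneous_monomial 1 hd
  have ht : (monomial (ev e) 1 : P 5).totalDegree = 9 :=
    IsHomogeneous.totalDegree hom (by simp)
  rw [SqK, ht, Finset.sum_eq_single 9]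
  · rw [homogeneousComponent_of_mem hom, if_pos rfl]
  · intro d _ hd
    rw [homogeneousComponent_of_mem hom, if_neg hd, map_zero, map_zero]
  · simp

lemma coeff_R (e : Fin 5 → ℕ) (he : Bty e) (v : Fin 5 → ℕ) (hv : ∑ i, v i = 10) :
    coeff (ev v) (SqK 5 1 (monomial (ev e) 1)) = ∏ i, c2 (e i) (v i) := by
  rw [R_eq e he, coeff_homogeneousComponent, mdeg_degree, if_pos, coeff_sqTot_s18]
  · rfl
  · exact hv

lemma final (f : P 5) (hf : f ∈ PnLe 5 10 w43)
    (hA : ∀ v, Aty v → coeff (ev v) f = 0)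
    (hB : ∀ e p q, Bty e → e p = 1 → e q = 1 →
      coeff (ev (Function.update e p 2)) f = coeff (ev (Function.update e q 2)) f) : f ∈ M5 := by
  classical
  let E : Finset (Fin 5 → ℕ) :=
    (Fintype.piFinset fun _ => ({1, 3} : Finset ℕ)).filter fun e => ∑ i, e i = 9
  have hE : ∀ e, e ∈ E ↔ Bty e := fun e => by
    simp only [E, Finset.mem_filter, Fintype.mem_piFinset, Finset.mem_insert,
      Finset.mem_singleton]
    exact ⟨fun h => ⟨h.2, h.1⟩, fun h => ⟨h.2, h.1⟩⟩
  let k : (Fin 5 → ℕ) → ZMod 2 := fun e =>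
    if h : ∃ p, e p = 1 then coeff (ev (Function.update e h.choose 2)) f else 0
  have hk : ∀ e p, Bty e → e p = 1 → coeff (ev (Function.update e p 2)) f = k e := by
    intro e p he hp
    have h : ∃ p, e p = 1 := ⟨p, hp⟩
    simp only [k, dif_pos h]
    exact hB e _ _ he hp h.choose_spec
  let S : P 5 := ∑ e ∈ E, k e • SqK 5 1 (monomial (ev e) 1)
  have hS : S ∈ hitS 5 := Submodule.sum_mem _ fun e _ => Submodule.smul_mem _ _
    (Submodule.subset_span ⟨1, le_rfl, _, rfl⟩)
  have hSh : S ∈ homogeneousSubmodule (Fin 5) (ZMod 2) 10 :=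
    Submodule.sum_mem _ fun e he => Submodule.smul_mem _ _ (by
      rw [R_eq e ((hE e).1 he)]
      exact homogeneousComponent_mem _ _)
  have hfh : f ∈ homogeneousSubmodule (Fin 5) (ZMod 2) 10 := by
    refine (Submodule.span_le.2 ?_ : PnLe 5 10 w43 ≤ _) hf
    rintro _ ⟨a, ha, _, rfl⟩
    exact isHomogeneous_monomial 1 (by rw [mdeg_degree, ha])
  have hg : f - S ∈ PnLt 5 10 w43 := by
    have hgh : f - S ∈ homogeneousSubmodule (Fin 5) (ZMod 2) 10 := Submodule.sub_mem _ hfh hSh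
    rw [(f - S).as_sum]
    refine Submodule.sum_mem _ fun a ha => ?_
    have ha0 : coeff a (f - S) ≠ 0 := mem_support_iff.1 ha
    have had : mdeg a = 10 := by
      by_contra hne
      exact ha0 (IsHomogeneous.coeff_eq_zero hgh (by rwa [mdeg_degree]))
    obtain ⟨v, rfl⟩ : ∃ v, a = ev v := ⟨a, (ev_coe5 a).symm⟩
    rcases classify_s18 v had with hl | ⟨h0, h3⟩
    · have : (monomial (ev v) (coeff (ev v) (f - S)) : P 5)
          = coeff (ev v) (f - S) • monomial (ev v) 1 := by rw [smul_monomial]; simp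
      rw [this]
      exact Submodule.smul_mem _ _ (Submodule.subset_span ⟨_, had, hl, rfl⟩)
    · exfalso
      apply ha0
      rw [coeff_sub]
      have had' : ∑ i, v i = 10 := had
      rcases typeAB v had h0 h3 with hv | ⟨e, p, he, hp, rfl⟩
      · rw [hA v hv, killA v hv S (Submodule.mem_sup_left hS), sub_zero]
      · rw [hk e p he hp, sub_eq_zero]
        simp only [S, coeff_sum, coeff_smul]
        rw [Finset.sum_eq_single e]
        · rw [coeff_R e he _ had', prodB e e he p hp, if_pos (Or.inl rfl), smul_eq_mul, mul_one]
        · intro e' he' hne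
          rw [coeff_R e' ((hE e').1 he') _ had', prodB e' e he p hp, if_neg, smul_zero]
          rintro (h | h)
          · exact hne h
          · have h1 := ((hE e').1 he').he p
            rw [h, Function.update_self] at h1
            omega
        · intro h; exact absurd ((hE e).2 he) h
  have : f = S + (f - S) := by ring
  rw [this]
  exact Submodule.add_mem_sup hS hg

/-- with `ω = (4,3)`, every `f ∈ P_5(ω)` with
`ρ_i(f) + f ∈ A^+P_5 + P_5^−(ω)` for all `1 ≤ i ≤ 5` satisfies
`f ∈ A^+P_5 + P_5^−(ω)`; i.e. the `GL_5`-invariant subspace of `QP_5(4,3)` is zero. -/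
theorem statement18 :
    ∀ f ∈ PnLe 5 10 w43,
      (∀ i : ℕ, 1 ≤ i → i ≤ 5 → rho5 i f + f ∈ hitS 5 ⊔ PnLt 5 10 w43) →
        f ∈ hitS 5 ⊔ PnLt 5 10 w43 := by
  intro f hf hinv
  have hS : ∀ σ, InvS f σ := by
    apply InvS_all
    intro i
    apply InvS_of
    have := hinv (i + 1) (by omega) (by omega)
    fin_cases i <;> simpa [rho5, M5] using this
  refine final f hf ?_ ?_
  · have h5 := killA ![0, 1, 3, 3, 3] ⟨by decide, by decide, by decide⟩ _ (hinv 5 (by omega) le_rfl)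
    rw [coeff_add, coeff_rho5] at h5
    have h6 : coeff (ev ![1, 0, 3, 3, 3]) f = 0 := by
      rw [← h5, add_right_comm, CharTwo.add_self_eq_zero, zero_add]
    intro v hv
    obtain ⟨σ, rfl⟩ := Aty_form v hv
    rw [(hS σ).1 _ ⟨by decide, by decide, by decide⟩, h6]
  · intro e q r he hq hr
    by_cases hqr : q = r
    · rw [hqr]
    obtain ⟨p, hp, hpq, hpr⟩ : ∃ p, e p = 1 ∧ p ≠ q ∧ p ≠ r := by
      by_contra hcon
      push Not at hcon
      have hs := he.hs
      have h0 := he.he 0; have h1 := he.he 1; have h2 := he.he 2; have h3 := he.he 3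
      have h4 := he.he 4
      have c0 := hcon 0; have c1 := hcon 1; have c2 := hcon 2; have c3 := hcon 3
      have c4 := hcon 4
      clear hcon hS hinv he hf
      simp only [Fin.sum_univ_five] at hs
      fin_cases q <;> fin_cases r <;> simp at * <;> omega
    have := (hS (Equiv.swap q r)).2 e p q he hp hq
    have hes : e ∘ Equiv.swap q r = e := by
      funext i
      simp only [Function.comp, Equiv.swap_apply_def]
      split_ifs with h1 h2
      · rw [h1, hq, hr]
      · rw [h2, hq, hr]
      · rfl
    rw [upd_comp, upd_comp, hes, Equiv.symm_swap, Equiv.swap_apply_of_ne_of_ne hpq hpr,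
      Equiv.swap_apply_left] at this
    exact (add_left_cancel this).symm
end
end
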